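/- Let B₀^{H,K} be a bifractional Brownian motion in ℝ with indices H ∈ (0,1) and K ∈ (0,1]. There exist positive constants c₂ and c₃ such that for all t₀ ∈ [0,1] and all x ∈ (0,1): exp(−c₂ / x^{1/(HK)}) ≤ P{ max_{t ∈ [0,1]} |B₀^{H,K}(t) − B₀^{H,K}(t₀)| ≤ x } ≤ exp(−c₃ / x^{1/(HK)}). -/

import Mathlib

open MeasureTheory ProbabilityTheory

/-- The bifractional covariance function. -/
noncomputable def Rbif (H K s t : ℝ) : ℝ :=
  (2 : ℝ) ^ (-K) * ((t ^ (2 * H) + s ^ (2 * H)) ^ K - |t - s| ^ (2 * H * K))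

/-- `B` is a bifractional Brownian motion in `ℝ` with indices `H, K` on `(Ω, μ)`. -/
def IsBifBM {Ω : Type*} [MeasurableSpace Ω] (μ : Measure Ω) (H K : ℝ)
    (B : ℝ → Ω → ℝ) : Prop :=
  (∀ᵐ ω ∂μ, ContinuousOn (fun t => B t ω) (Set.Ici 0)) ∧
  ∀ (n : ℕ) (t : Fin n → ℝ), (∀ i, 0 ≤ t i) → ∀ a : Fin n → ℝ,
    Measure.map (fun ω => ∑ i, a i * B (t i) ω) μ =
      gaussianReal 0 (Real.toNNReal (∑ i, ∑ j, a i * a j * Rbif H K (t i) (t j)))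

namespace BifSB

/-- `ν` has the characteristic function of a centered Gaussian vector with quadratic form `q`. -/
def GaussV {ι : Type*} [Fintype ι] (ν : Measure (ι → ℝ)) (q : (ι → ℝ) → ℝ) : Prop :=
  ∀ a : ι → ℝ, ∫ y, Complex.exp (((∑ i, a i * y i : ℝ) : ℂ) * Complex.I) ∂ν
    = Complex.exp (((-(q a) / 2 : ℝ)) : ℂ)

section
variable {ι : Type*} [Fintype ι]

lemma gaussV_unique {ν₁ ν₂ : Measure (ι → ℝ)} [IsProbabilityMeasure ν₁] [IsProbabilityMeasure ν₂]
    {q : (ι → ℝ) → ℝ} (h₁ : GaussV ν₁ q) (h₂ : GaussV ν₂ q) : ν₁ = ν₂ := by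
  classical
  apply Measure.ext_of_charFunDual
  ext L
  have hL : ∀ y : ι → ℝ, L y = ∑ i, L (Pi.single i 1) * y i := by
    intro y
    conv_lhs => rw [← Finset.univ_sum_single y]
    rw [map_sum]
    refine Finset.sum_congr rfl fun i _ => ?_
    have : (Pi.single i (y i) : ι → ℝ) = y i • (Pi.single i (1:ℝ) : ι → ℝ) := by
      ext j; by_cases h : j = i
      · subst h; simp
      · simp [h]
    rw [this, map_smul, smul_eq_mul, mul_comm]
  rw [charFunDual_apply, charFunDual_apply]
  have e : ∀ ν : Measure (ι → ℝ), ∫ v, Complex.exp ((L v : ℂ) * Complex.I) ∂ν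
      = ∫ y, Complex.exp (((∑ i, (fun i => L (Pi.single i 1)) i * y i : ℝ) : ℂ) * Complex.I) ∂ν := by
    intro ν
    refine integral_congr_ae (Filter.Eventually.of_forall fun y => ?_)
    beta_reduce
    rw [← hL y]
  rw [e, e, h₁, h₂]

lemma gaussV_exists [DecidableEq ι] (S : Matrix ι ι ℝ) (hS : S.PosSemidef) :
    ∃ ν : Measure (ι → ℝ), IsProbabilityMeasure ν ∧
      GaussV ν (fun a => ∑ i, ∑ j, a i * a j * S i j) := by
  refine ⟨(multivariateGaussian 0 S).map (fun y i => y i), ?_, ?_⟩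
  · apply Measure.isProbabilityMeasure_map
    fun_prop
  · intro a
    rw [integral_map (by fun_prop) (Continuous.aestronglyMeasurable (by fun_prop))]
    have := charFun_multivariateGaussian (μ := 0) hS (WithLp.toLp 2 a)
    rw [charFun_apply] at this
    simp only [inner_zero_right] at this
    convert this using 2
    · ext y
      congr 3
    · have e : a ⬝ᵥ S.mulVec a = ∑ i, ∑ j, a i * a j * S i j := by
        simp only [dotProduct, Matrix.mulVec, Finset.mul_sum]
        refine Finset.sum_congr rfl fun i _ => Finset.sum_congr rfl fun j _ => ?_
        ring
      rw [e]
      push_cast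
      ring

lemma gaussV_conv {ν₁ ν₂ : Measure (ι → ℝ)} [IsProbabilityMeasure ν₁] [IsProbabilityMeasure ν₂]
    {q₁ q₂ : (ι → ℝ) → ℝ} (h₁ : GaussV ν₁ q₁) (h₂ : GaussV ν₂ q₂) (c d : ℝ) :
    GaussV ((ν₁.prod ν₂).map (fun p => c • p.1 + d • p.2))
      (fun a => q₁ (c • a) + q₂ (d • a)) := by
  intro a
  rw [integral_map (by fun_prop) (Continuous.aestronglyMeasurable (by fun_prop))]
  have : ∀ p : (ι → ℝ) × (ι → ℝ),
      Complex.exp (((∑ i, a i * (c • p.1 + d • p.2) i : ℝ) : ℂ) * Complex.I)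
      = Complex.exp (((∑ i, (c • a) i * p.1 i : ℝ) : ℂ) * Complex.I) *
        Complex.exp (((∑ i, (d • a) i * p.2 i : ℝ) : ℂ) * Complex.I) := by
    intro p
    rw [← Complex.exp_add, ← add_mul, ← Complex.ofReal_add, ← Finset.sum_add_distrib]
    congr 4
    ext i; simp; ring
  simp_rw [this]
  rw [integral_prod_mul (fun y : ι → ℝ => Complex.exp (((∑ i, (c • a) i * y i : ℝ) : ℂ) * Complex.I))
    (fun y : ι → ℝ => Complex.exp (((∑ i, (d • a) i * y i : ℝ) : ℂ) * Complex.I)), h₁, h₂,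
    ← Complex.exp_add, ← Complex.ofReal_add]
  congr 2
  ring

lemma gaussV_pi (v : ι → NNReal) :
    GaussV (Measure.pi fun i => gaussianReal 0 (v i)) (fun a => ∑ i, a i ^ 2 * v i) := by
  intro a
  have : ∀ y : ι → ℝ, Complex.exp (((∑ i, a i * y i : ℝ) : ℂ) * Complex.I)
      = ∏ i, (fun i (t : ℝ) => Complex.exp ((a i : ℂ) * t * Complex.I)) i (y i) := by
    intro y
    rw [← Complex.exp_sum]
    push_cast
    rw [Finset.sum_mul]
  simp_rw [this]
  rw [integral_fintype_prod_eq_prod (fun i (t : ℝ) => Complex.exp ((a i : ℂ) * t * Complex.I))]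
  have h2 : ∀ i, ∫ t : ℝ, Complex.exp ((a i : ℂ) * t * Complex.I) ∂(gaussianReal 0 (v i))
      = Complex.exp (((-(a i ^ 2 * v i) / 2 : ℝ)) : ℂ) := by
    intro i
    rw [← charFun_apply_real, charFun_gaussianReal]
    congr 1
    push_cast
    ring
  simp_rw [h2]
  rw [← Complex.exp_sum]
  congr 1
  push_cast
  rw [← Finset.sum_div, Finset.sum_neg_distrib]

lemma posSemidef_of_form [DecidableEq ι] (S : Matrix ι ι ℝ) (hs : ∀ i j, S i j = S j i)
    (h : ∀ a : ι → ℝ, 0 ≤ ∑ i, ∑ j, a i * a j * S i j) : S.PosSemidef := by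
  refine Matrix.PosSemidef.of_dotProduct_mulVec_nonneg ?_ ?_
  · ext i j; simp [hs j i]
  · intro x
    have := h x
    simp only [dotProduct, Matrix.mulVec, Finset.mul_sum, Pi.star_apply, star_trivial]
    refine this.trans_eq (Finset.sum_congr rfl fun i _ => Finset.sum_congr rfl fun j _ => ?_)
    ring

/-- decomposition -/
lemma gaussV_decomp [DecidableEq ι] {ν₁ ν₂ : Measure (ι → ℝ)} [IsProbabilityMeasure ν₁]
    [IsProbabilityMeasure ν₂] (S₁ S₂ : ι → ι → ℝ)
    (hs₁ : ∀ i j, S₁ i j = S₁ j i) (hs₂ : ∀ i j, S₂ i j = S₂ j i)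
    (h₁ : GaussV ν₁ (fun a => ∑ i, ∑ j, a i * a j * S₁ i j))
    (h₂ : GaussV ν₂ (fun a => ∑ i, ∑ j, a i * a j * S₂ i j))
    (h : ∀ a : ι → ℝ, ∑ i, ∑ j, a i * a j * S₁ i j ≤ ∑ i, ∑ j, a i * a j * S₂ i j) :
    ∃ ζ : Measure (ι → ℝ), IsProbabilityMeasure ζ ∧
      ν₂ = (ν₁.prod ζ).map (fun p => p.1 + p.2) := by
  obtain ⟨ζ, hζ, hζG⟩ := gaussV_exists (Matrix.of fun i j => S₂ i j - S₁ i j)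
    (posSemidef_of_form _ (fun i j => by simp [hs₁ i j, hs₂ i j]) (fun a => by
      have := h a
      simp only [Matrix.of_apply, mul_sub, Finset.sum_sub_distrib]
      linarith))
  refine ⟨ζ, hζ, ?_⟩
  have hc := gaussV_conv h₁ hζG 1 1
  simp only [one_smul] at hc
  have : IsProbabilityMeasure ((ν₁.prod ζ).map (fun p => p.1 + p.2)) :=
    Measure.isProbabilityMeasure_map (by fun_prop)
  refine gaussV_unique h₂ ?_
  convert hc using 2
  simp only [Matrix.of_apply, mul_sub, Finset.sum_sub_distrib]
  ring

lemma gaussV_diag_form [DecidableEq ι] (v : ι → ℝ) (a : ι → ℝ) :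
    ∑ i, ∑ j, a i * a j * (if i = j then v i else 0) = ∑ i, a i ^ 2 * v i := by
  refine Finset.sum_congr rfl fun i _ => ?_
  simp [sq]

/-- Weak Sidak inequality. -/
lemma weak_sidak [DecidableEq ι] {ν : Measure (ι → ℝ)} [IsProbabilityMeasure ν]
    (S : ι → ι → ℝ) (hs : ∀ i j, S i j = S j i)
    (hν : GaussV ν (fun a => ∑ i, ∑ j, a i * a j * S i j)) (v : ι → NNReal)
    (h : ∀ a : ι → ℝ, ∑ i, ∑ j, a i * a j * S i j ≤ ∑ i, a i ^ 2 * v i) (x : ι → ℝ) :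
    (∏ i, gaussianReal 0 (v i) {y | |y| ≤ x i}) ^ 2 ≤ ν {y | ∀ i, |y i| ≤ Real.sqrt 2 * x i} := by
  set A : Set (ι → ℝ) := {y | ∀ i, |y i| ≤ x i} with hA
  have hAm : MeasurableSet A := by
    rw [hA, Set.ofPred_forall]
    exact MeasurableSet.iInter fun i => measurableSet_le (by fun_prop) (by fun_prop)
  set A' : Set (ι → ℝ) := {y | ∀ i, |y i| ≤ Real.sqrt 2 * x i} with hA'
  have hA'm : MeasurableSet A' := by
    rw [hA', Set.ofPred_forall]
    exact MeasurableSet.iInter fun i => measurableSet_le (by fun_prop) (by fun_prop)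
  set ρ := Measure.pi fun i => gaussianReal 0 (v i) with hρ
  have hρA : ρ A = ∏ i, gaussianReal 0 (v i) {y | |y| ≤ x i} := by
    have : A = Set.pi Set.univ (fun i => {y : ℝ | |y| ≤ x i}) := by
      ext y; simp [hA]
    rw [this, hρ, Measure.pi_pi]
  rw [← hρA]
  have hρG := gaussV_pi v
  have hρG' : GaussV ρ (fun a => ∑ i, ∑ j, a i * a j * (if i = j then (v i : ℝ) else 0)) := by
    simp_rw [gaussV_diag_form (fun i => (v i : ℝ))]
    exact hρG
  obtain ⟨ζ, hζ, hρζ⟩ := gaussV_decomp S (fun i j => if i = j then (v i : ℝ) else 0) hs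
    (fun i j => by
      by_cases hij : i = j
      · subst hij; simp
      · simp [hij, Ne.symm hij]) hν hρG'
    (fun a => by rw [gaussV_diag_form (fun i => (v i : ℝ))]; exact h a)
  have hself : ν = (ν.prod ν).map (fun p => (1 / Real.sqrt 2) • p.1 + (-(1 / Real.sqrt 2)) • p.2) := by
    have hc := gaussV_conv hν hν (1 / Real.sqrt 2) (-(1 / Real.sqrt 2))
    have : IsProbabilityMeasure ((ν.prod ν).map
        (fun p => (1 / Real.sqrt 2) • p.1 + (-(1 / Real.sqrt 2)) • p.2)) :=
      Measure.isProbabilityMeasure_map (by fun_prop)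
    refine gaussV_unique hν ?_
    convert hc using 2 with a
    have h2 : (1 / Real.sqrt 2) * (1 / Real.sqrt 2) = 1 / 2 := by
      rw [div_mul_div_comm, Real.mul_self_sqrt (by norm_num)]; norm_num
    rw [← Finset.sum_add_distrib]
    refine Finset.sum_congr rfl fun i _ => ?_
    rw [← Finset.sum_add_distrib]
    refine Finset.sum_congr rfl fun j _ => ?_
    simp only [Pi.smul_apply, smul_eq_mul]
    linear_combination (-2 * (a i * a j * S i j)) * h2
  have key : ∀ z : ι → ℝ, (ν ((fun y => y + z) ⁻¹' A)) ^ 2 ≤ ν A' := by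
    intro z
    rw [sq, ← Measure.prod_prod]
    conv_rhs => rw [hself]
    rw [Measure.map_apply (by fun_prop) hA'm]
    apply measure_mono
    rintro ⟨y₁, y₂⟩ ⟨h₁, h₂⟩ i
    have h₁ := h₁ i
    have h₂ := h₂ i
    simp only [Pi.add_apply] at h₁ h₂
    simp only [Pi.add_apply, Pi.smul_apply, smul_eq_mul]
    have hs2 : 0 < Real.sqrt 2 := by positivity
    have e : 1 / Real.sqrt 2 * y₁ i + -(1 / Real.sqrt 2) * y₂ i
        = ((y₁ i + z i) - (y₂ i + z i)) / Real.sqrt 2 := by field_simp; ring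
    rw [e, abs_div, abs_of_pos hs2, div_le_iff₀ hs2]
    calc |y₁ i + z i - (y₂ i + z i)| ≤ |y₁ i + z i| + |y₂ i + z i| := abs_sub _ _
      _ ≤ 2 * x i := by linarith
      _ = Real.sqrt 2 * x i * Real.sqrt 2 := by
        have := Real.mul_self_sqrt (show (0:ℝ) ≤ 2 by norm_num)
        linear_combination (- x i) * this
  have key2 : ∀ z : ι → ℝ, ν ((fun y => y + z) ⁻¹' A) ≤ (ν A') ^ (1/2 : ℝ) := by
    intro z
    rw [one_div, ENNReal.le_rpow_inv_iff (by norm_num)]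
    exact_mod_cast key z
  have : ρ A ≤ (ν A') ^ (1/2 : ℝ) := by
    rw [hρζ, Measure.map_apply (by fun_prop) hAm, Measure.prod_apply_symm (hAm.preimage (by fun_prop))]
    calc _ ≤ ∫⁻ z, (ν A') ^ (1/2 : ℝ) ∂ζ := by
          apply lintegral_mono
          intro z
          exact key2 z
      _ = _ := by simp
  rw [one_div, ENNReal.le_rpow_inv_iff (by norm_num)] at this
  exact_mod_cast this

lemma gaussian_interval_le (l z x : ℝ) (hl : 0 < l) :
    gaussianReal 0 l.toNNReal {y | |y + z| ≤ x} ≤ ENNReal.ofReal (2 * x / Real.sqrt (2 * Real.pi * l)) := by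
  have hv : l.toNNReal ≠ 0 := by simpa using hl
  rw [gaussianReal_apply 0 hv]
  have : {y : ℝ | |y + z| ≤ x} = Set.Icc (-x - z) (x - z) := by
    ext y; simp only [Set.mem_ofPred_eq, abs_le, Set.mem_Icc]
    constructor <;> rintro ⟨h1, h2⟩ <;> constructor <;> linarith
  rw [this]
  calc _ ≤ ∫⁻ y in Set.Icc (-x - z) (x - z), ENNReal.ofReal (1 / Real.sqrt (2 * Real.pi * l)) := by
        apply lintegral_mono
        intro y
        apply ENNReal.ofReal_le_ofReal
        rw [gaussianPDFReal_def, one_div]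
        simp only [Real.coe_toNNReal l hl.le]
        apply mul_le_of_le_one_right (by positivity)
        rw [Real.exp_le_one_iff]
        have : 0 ≤ (y - 0) ^ 2 / (2 * l) := by positivity
        rw [neg_div]; linarith
    _ = _ := by
      rw [setLIntegral_const, Real.volume_Icc, ← ENNReal.ofReal_mul (by positivity)]
      congr 1; ring

lemma upper_box [DecidableEq ι] {ν : Measure (ι → ℝ)} [IsProbabilityMeasure ν]
    (S : ι → ι → ℝ) (hs : ∀ i j, S i j = S j i)
    (hν : GaussV ν (fun a => ∑ i, ∑ j, a i * a j * S i j)) (l : ℝ) (hl : 0 < l)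
    (h : ∀ a : ι → ℝ, l * ∑ i, a i ^ 2 ≤ ∑ i, ∑ j, a i * a j * S i j) (x : ℝ) (hx : 0 ≤ x) :
    ν {y | ∀ i, |y i| ≤ x} ≤
      ENNReal.ofReal (2 * x / Real.sqrt (2 * Real.pi * l)) ^ (Fintype.card ι) := by
  set A : Set (ι → ℝ) := {y | ∀ i, |y i| ≤ x} with hA
  have hAm : MeasurableSet A := by
    rw [hA, Set.ofPred_forall]
    exact MeasurableSet.iInter fun i => measurableSet_le (by fun_prop) (by fun_prop)
  set ρ : Measure (ι → ℝ) := Measure.pi fun i => gaussianReal 0 l.toNNReal with hρ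
  have hρG' : GaussV ρ (fun a => ∑ i, ∑ j, a i * a j * (if i = j then l else 0)) := by
    simp_rw [gaussV_diag_form (fun i => l)]
    have := gaussV_pi (ι := ι) (fun _ => l.toNNReal)
    simp only [Real.coe_toNNReal l hl.le] at this
    exact this
  obtain ⟨ζ, hζ, hρζ⟩ := gaussV_decomp (fun i j => if i = j then l else 0) S
    (fun i j => by simp [eq_comm]) hs hρG' hν
    (fun a => by
      rw [gaussV_diag_form (fun i => l), ← Finset.sum_mul, mul_comm]; exact h a)
  rw [hρζ, Measure.map_apply (by fun_prop) hAm, Measure.prod_apply_symm (hAm.preimage (by fun_prop))]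
  calc _ ≤ ∫⁻ z, ENNReal.ofReal (2 * x / Real.sqrt (2 * Real.pi * l)) ^ (Fintype.card ι) ∂ζ := by
        apply lintegral_mono
        intro z
        have : (fun y => (y, z)) ⁻¹' ((fun p : (ι → ℝ) × (ι → ℝ) => p.1 + p.2) ⁻¹' A)
            = Set.pi Set.univ (fun i => {y : ℝ | |y + z i| ≤ x}) := by
          ext y; simp [hA]
        beta_reduce
        rw [this, hρ, Measure.pi_pi]
        calc _ ≤ ∏ i : ι, ENNReal.ofReal (2 * x / Real.sqrt (2 * Real.pi * l)) :=
              Finset.prod_le_prod' fun i _ => gaussian_interval_le l (z i) x hl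
          _ = _ := by simp
    _ = _ := by simp

end
end BifSB

namespace BifSB

/-- normalizing constant in the Laplace representation of `x ^ K`. -/
noncomputable def cpow (K : ℝ) : ℝ := ∫ r in Set.Ioi (0:ℝ), (1 - Real.exp (-r)) * r ^ (-1 - K)

lemma cpow_integrable {K : ℝ} (h0 : 0 < K) (h1 : K < 1) :
    IntegrableOn (fun r : ℝ => (1 - Real.exp (-r)) * r ^ (-1 - K)) (Set.Ioi 0) := by
  have hcont : ContinuousOn (fun r : ℝ => (1 - Real.exp (-r)) * r ^ (-1 - K)) (Set.Ioi 0) := by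
    apply ContinuousOn.mul
    · fun_prop
    · exact ContinuousOn.rpow_const continuousOn_id (fun x hx => Or.inl (ne_of_gt hx))
  rw [← Set.Ioc_union_Ioi_eq_Ioi (zero_le_one (α := ℝ))]
  apply IntegrableOn.union
  · have hi : IntegrableOn (fun r : ℝ => r ^ (-K)) (Set.Ioc 0 1) := by
      have := intervalIntegral.intervalIntegrable_rpow' (a := 0) (b := 1) (r := -K) (by linarith)
      rwa [intervalIntegrable_iff_integrableOn_Ioc_of_le zero_le_one] at this
    refine Integrable.mono' hi ((hcont.mono Set.Ioc_subset_Ioi_self).aestronglyMeasurable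
      measurableSet_Ioc) ?_
    refine (ae_restrict_iff' measurableSet_Ioc).2 (Filter.Eventually.of_forall fun r hr => ?_)
    have hr0 : 0 < r := hr.1
    have e1 : 0 ≤ 1 - Real.exp (-r) := by
      have : Real.exp (-r) ≤ 1 := Real.exp_le_one_iff.2 (by linarith)
      linarith
    rw [Real.norm_of_nonneg (mul_nonneg e1 (Real.rpow_nonneg hr0.le _))]
    have e2 : 1 - Real.exp (-r) ≤ r := by
      have := Real.add_one_le_exp (-r); linarith
    calc _ ≤ r * r ^ (-1 - K) := mul_le_mul_of_nonneg_right e2 (Real.rpow_nonneg hr0.le _)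
      _ = r ^ (-K) := by
        rw [← Real.rpow_one_add' hr0.le (by linarith)]; congr 1; ring
  · have hi : IntegrableOn (fun r : ℝ => r ^ (-1 - K)) (Set.Ioi 1) :=
      integrableOn_Ioi_rpow_of_lt (by linarith) zero_lt_one
    refine Integrable.mono' hi ((hcont.mono (Set.Ioi_subset_Ioi zero_le_one)).aestronglyMeasurable
      measurableSet_Ioi) ?_
    refine (ae_restrict_iff' measurableSet_Ioi).2 (Filter.Eventually.of_forall fun r hr => ?_)
    have hr0 : 0 < r := lt_trans zero_lt_one hr
    have e1 : 0 ≤ 1 - Real.exp (-r) := by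
      have : Real.exp (-r) ≤ 1 := Real.exp_le_one_iff.2 (by linarith)
      linarith
    rw [Real.norm_of_nonneg (mul_nonneg e1 (Real.rpow_nonneg hr0.le _))]
    apply mul_le_of_le_one_left (Real.rpow_nonneg hr0.le _)
    have := Real.exp_pos (-r); linarith

lemma cpow_pos {K : ℝ} (h0 : 0 < K) (h1 : K < 1) : 0 < cpow K := by
  unfold cpow
  have hpos : ∀ r ∈ Set.Ioi (0:ℝ), 0 < (1 - Real.exp (-r)) * r ^ (-1 - K) := by
    intro r hr
    apply mul_pos
    · have : Real.exp (-r) < 1 := Real.exp_lt_one_iff.2 (by simpa using hr)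
      linarith
    · exact Real.rpow_pos_of_pos hr _
  rw [setIntegral_pos_iff_support_of_nonneg_ae]
  · have : Function.support (fun r : ℝ => (1 - Real.exp (-r)) * r ^ (-1 - K)) ∩ Set.Ioi 0
        = Set.Ioi 0 := by
      apply Set.inter_eq_right.2
      intro r hr
      exact (hpos r hr).ne'
    rw [this]; simp
  · refine (ae_restrict_iff' measurableSet_Ioi).2 (Filter.Eventually.of_forall fun r hr => ?_)
    exact (hpos r hr).le
  · exact cpow_integrable h0 h1

lemma pow_integrable {K : ℝ} (h0 : 0 < K) (h1 : K < 1) {x : ℝ} (hx : 0 ≤ x) :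
    IntegrableOn (fun r : ℝ => (1 - Real.exp (-(x * r))) * r ^ (-1 - K)) (Set.Ioi 0) := by
  rcases hx.eq_or_lt with rfl | hx
  · simp
  have := (integrableOn_Ioi_comp_mul_left_iff
    (fun r : ℝ => (1 - Real.exp (-r)) * r ^ (-1 - K)) 0 hx).2
    (by simpa using cpow_integrable h0 h1)
  have := this.const_mul (x ^ (1 + K))
  refine this.congr ((ae_restrict_iff' measurableSet_Ioi).2
    (Filter.Eventually.of_forall fun r hr => ?_))
  have hr0 : 0 < r := hr
  simp only
  rw [Real.mul_rpow hx.le hr0.le]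
  have : x ^ (1 + K) * x ^ (-1 - K) = 1 := by
    rw [← Real.rpow_add hx]; simp
  linear_combination ((1 - Real.exp (-(x * r))) * r ^ (-1 - K)) * this

lemma pow_integral {K : ℝ} (h0 : 0 < K) {x : ℝ} (hx : 0 ≤ x) :
    ∫ r in Set.Ioi (0:ℝ), (1 - Real.exp (-(x * r))) * r ^ (-1 - K) = cpow K * x ^ K := by
  rcases hx.eq_or_lt with rfl | hx
  · simp [Real.zero_rpow h0.ne']
  have h := integral_comp_mul_left_Ioi (fun r : ℝ => (1 - Real.exp (-r)) * r ^ (-1 - K)) 0 hx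
  rw [mul_zero] at h
  have : ∫ r in Set.Ioi (0:ℝ), (1 - Real.exp (-(x * r))) * r ^ (-1 - K)
      = ∫ r in Set.Ioi (0:ℝ), x ^ (1 + K) * ((1 - Real.exp (-(x * r))) * (x * r) ^ (-1 - K)) := by
    refine setIntegral_congr_fun measurableSet_Ioi fun r hr => ?_
    have hr0 : 0 < r := hr
    beta_reduce
    rw [Real.mul_rpow hx.le hr0.le]
    have : x ^ (1 + K) * x ^ (-1 - K) = 1 := by
      rw [← Real.rpow_add hx]; simp
    linear_combination (-((1 - Real.exp (-(x * r))) * r ^ (-1 - K))) * this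
  rw [this, integral_const_mul, h, smul_eq_mul, ← mul_assoc]
  change _ * cpow K = _
  rw [← Real.rpow_neg_one x, ← Real.rpow_add hx]
  rw [mul_comm]; congr 2; ring

/-- Laplace representation of finite linear combinations. -/
lemma sum_pow_integrable {K : ℝ} (h0 : 0 < K) (h1 : K < 1) {σ : Type*} [Fintype σ] (c x : σ → ℝ)
    (hx : ∀ i, 0 ≤ x i) :
    IntegrableOn (fun r : ℝ => (∑ i, c i * (1 - Real.exp (-(x i * r)))) * r ^ (-1 - K)) (Set.Ioi 0) := by
  simp_rw [Finset.sum_mul, mul_assoc]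
  exact integrable_finsetSum _ fun i _ => (pow_integrable h0 h1 (hx i)).const_mul (c i)

lemma sum_pow_integral {K : ℝ} (h0 : 0 < K) (h1 : K < 1) {σ : Type*} [Fintype σ] (c x : σ → ℝ)
    (hx : ∀ i, 0 ≤ x i) :
    ∫ r in Set.Ioi (0:ℝ), (∑ i, c i * (1 - Real.exp (-(x i * r)))) * r ^ (-1 - K)
      = cpow K * ∑ i, c i * x i ^ K := by
  simp_rw [Finset.sum_mul, mul_assoc]
  rw [integral_finsetSum _ fun i _ => (pow_integrable h0 h1 (hx i)).const_mul (c i)]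
  simp_rw [integral_const_mul, pow_integral h0 (hx _)]
  rw [Finset.mul_sum]
  exact Finset.sum_congr rfl fun i _ => by ring

section
variable {ι : Type*} [Fintype ι]

lemma exp_psd (S : ι → ι → ℝ) (hs : ∀ i j, S i j = S j i)
    (h : ∀ a : ι → ℝ, 0 ≤ ∑ i, ∑ j, a i * a j * S i j) (a : ι → ℝ) :
    0 ≤ ∑ i, ∑ j, a i * a j * Real.exp (S i j) := by
  classical
  have toForm : ∀ (M : Matrix ι ι ℝ), M.PosSemidef → ∀ a : ι → ℝ,
      0 ≤ ∑ i, ∑ j, a i * a j * M i j := by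
    intro M hM a
    have := hM.dotProduct_mulVec_nonneg a
    simp only [dotProduct, Matrix.mulVec, Finset.mul_sum, Pi.star_apply, star_trivial] at this
    refine this.trans_eq (Finset.sum_congr rfl fun i _ => Finset.sum_congr rfl fun j _ => ?_)
    ring
  have ofForm : ∀ (M : Matrix ι ι ℝ), (∀ i j, M i j = M j i) → (∀ a : ι → ℝ,
      0 ≤ ∑ i, ∑ j, a i * a j * M i j) → M.PosSemidef := by
    intro M hs h
    refine Matrix.PosSemidef.of_dotProduct_mulVec_nonneg ?_ ?_
    · ext i j; simp [hs j i]
    · intro x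
      have := h x
      simp only [dotProduct, Matrix.mulVec, Finset.mul_sum, Pi.star_apply, star_trivial]
      refine this.trans_eq (Finset.sum_congr rfl fun i _ => Finset.sum_congr rfl fun j _ => ?_)
      ring
  have hpow : ∀ m : ℕ, (Matrix.of fun i j => S i j ^ m).PosSemidef := by
    intro m
    induction m with
    | zero =>
      apply ofForm
      · simp
      · intro a
        have : ∑ i, ∑ j, a i * a j * (Matrix.of fun i j => S i j ^ 0) i j = (∑ i, a i) ^ 2 := by
          simp [sq, Finset.sum_mul_sum]
        rw [this]; positivity
    | succ m ih =>
      have hS : (Matrix.of S).PosSemidef := ofForm _ (by simpa using hs) (by simpa using h)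
      have e : (Matrix.of fun i j => S i j ^ (m + 1))
          = (Matrix.of fun i j => S i j ^ m).hadamard (Matrix.of S) := by
        ext i j; simp [pow_succ]
      rw [e]
      exact ih.hadamard hS
  have hsum : HasSum (fun m : ℕ => ∑ i, ∑ j, a i * a j * (S i j ^ m / m.factorial))
      (∑ i, ∑ j, a i * a j * Real.exp (S i j)) := by
    refine hasSum_sum fun i _ => hasSum_sum fun j _ => ?_
    apply HasSum.mul_left
    have := NormedSpace.expSeries_div_hasSum_exp (S i j)
    rwa [← Real.exp_eq_exp_ℝ] at this
  refine hsum.nonneg fun m => ?_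
  have := toForm _ (hpow m) a
  have e : ∑ i, ∑ j, a i * a j * (S i j ^ m / m.factorial)
      = (∑ i, ∑ j, a i * a j * (Matrix.of fun i j => S i j ^ m) i j) / m.factorial := by
    simp only [Matrix.of_apply, Finset.sum_div]
    refine Finset.sum_congr rfl fun i _ => Finset.sum_congr rfl fun j _ => ?_
    ring
  rw [e]
  positivity

lemma conj_exp_form (S : ι → ι → ℝ) (u : ι → ℝ) (hs : ∀ i j, S i j = S j i)
    (h : ∀ a : ι → ℝ, 0 ≤ ∑ i, ∑ j, a i * a j * S i j) (a : ι → ℝ) :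
    0 ≤ ∑ i, ∑ j, a i * a j * Real.exp (S i j - u i - u j) := by
  have := exp_psd S hs h (fun i => a i * Real.exp (-u i))
  refine this.trans_eq (Finset.sum_congr rfl fun i _ => Finset.sum_congr rfl fun j _ => ?_)
  have : Real.exp (S i j - u i - u j) = Real.exp (-u i) * Real.exp (-u j) * Real.exp (S i j) := by
    rw [← Real.exp_add, ← Real.exp_add]; congr 1; ring
  rw [this]; ring

lemma gauss_kernel (t : ι → ℝ) {r : ℝ} (hr : 0 ≤ r) (a : ι → ℝ) :
    0 ≤ ∑ i, ∑ j, a i * a j * Real.exp (-((t i - t j) ^ 2 * r)) := by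
  have := conj_exp_form (fun i j => 2 * r * (t i * t j)) (fun i => r * t i ^ 2)
    (fun i j => by ring) (fun b => by
      have : ∑ i, ∑ j, b i * b j * (2 * r * (t i * t j)) = 2 * r * (∑ i, b i * t i) ^ 2 := by
        rw [sq, Finset.sum_mul_sum, Finset.mul_sum]
        refine Finset.sum_congr rfl fun i _ => ?_
        rw [Finset.mul_sum]
        exact Finset.sum_congr rfl fun j _ => by ring
      rw [this]; positivity) a
  refine this.trans_eq (Finset.sum_congr rfl fun i _ => Finset.sum_congr rfl fun j _ => ?_)
  congr 2; ring

lemma abs_rpow_two_mul (x h : ℝ) : |x| ^ (2 * h) = (x ^ 2) ^ h := by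
  rw [Real.rpow_mul (abs_nonneg x)]
  congr 1
  rw [← sq_abs]
  exact_mod_cast Real.rpow_natCast |x| 2

/-- `|x|^{2h}` is conditionally negative definite. -/
lemma cnd (t : ι → ℝ) {h : ℝ} (h0 : 0 < h) (h1 : h < 1) (a : ι → ℝ) (ha : ∑ i, a i = 0) :
    ∑ i, ∑ j, a i * a j * |t i - t j| ^ (2 * h) ≤ 0 := by
  have key := sum_pow_integral h0 h1 (σ := ι × ι) (fun p => a p.1 * a p.2)
    (fun p => (t p.1 - t p.2) ^ 2) (fun p => sq_nonneg _)
  have hle : ∫ r in Set.Ioi (0:ℝ), (∑ p : ι × ι, a p.1 * a p.2 *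
      (1 - Real.exp (-((t p.1 - t p.2) ^ 2 * r)))) * r ^ (-1 - h) ≤ 0 := by
    apply setIntegral_nonpos measurableSet_Ioi
    intro r hr
    have hr0 : 0 < r := hr
    apply mul_nonpos_of_nonpos_of_nonneg _ (Real.rpow_nonneg hr0.le _)
    have := gauss_kernel t hr0.le a
    rw [Fintype.sum_prod_type]
    simp only [mul_sub, mul_one, Finset.sum_sub_distrib]
    rw [← Finset.sum_mul_sum, ha]
    linarith
  rw [key, Fintype.sum_prod_type] at hle
  simp_rw [abs_rpow_two_mul]
  have hc := cpow_pos h0 h1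
  by_contra hcon
  push Not at hcon
  have := mul_pos hc hcon
  linarith

lemma stable_kernel (t : ι → ℝ) {h : ℝ} (h0 : 0 < h) (h1 : h ≤ 1) {r : ℝ} (hr : 0 ≤ r) (a : ι → ℝ) :
    0 ≤ ∑ i, ∑ j, a i * a j * Real.exp (-(|t i - t j| ^ (2 * h) * r)) := by
  rcases h1.eq_or_lt with rfl | h1
  · have := gauss_kernel t hr a
    refine this.trans_eq (Finset.sum_congr rfl fun i _ => Finset.sum_congr rfl fun j _ => ?_)
    rw [abs_rpow_two_mul, Real.rpow_one]
  have := conj_exp_form (fun i j => r * (|t i| ^ (2 * h) + |t j| ^ (2 * h) - |t i - t j| ^ (2 * h)))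
    (fun i => r * |t i| ^ (2 * h)) (fun i j => by rw [abs_sub_comm]; ring) (fun b => by
      have := cnd (ι := Option ι) (fun o => o.elim 0 t) h0 h1
        (fun o => o.elim (-∑ i, b i) b) (by simp [Fintype.sum_option])
      simp only [Fintype.sum_option, Option.elim_none, Option.elim_some, abs_zero,
        Real.zero_rpow (show 2 * h ≠ 0 by positivity), mul_zero, zero_add, zero_sub, abs_neg,
        sub_zero] at this
      have e : ∑ i, ∑ j, b i * b j * (r * (|t i| ^ (2 * h) + |t j| ^ (2 * h) - |t i - t j| ^ (2 * h)))
        = r * (2 * (∑ i, b i) * (∑ j, b j * |t j| ^ (2 * h)) -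
          ∑ i, ∑ j, b i * b j * |t i - t j| ^ (2 * h)) := by
        have e1 : 2 * (∑ i, b i) * (∑ j, b j * |t j| ^ (2 * h)) =
          ∑ i, ∑ j, (b i * b j * |t j| ^ (2 * h)) + ∑ i, ∑ j, (b i * b j * |t i| ^ (2 * h)) := by
          have e2 : ∑ i, ∑ j, (b i * b j * |t i| ^ (2 * h))
            = ∑ i, ∑ j, (b i * b j * |t j| ^ (2 * h)) := by
            rw [Finset.sum_comm]
            exact Finset.sum_congr rfl fun i _ => Finset.sum_congr rfl fun j _ => by ring
          rw [e2, mul_assoc, Finset.sum_mul_sum]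
          simp only [mul_assoc]
          ring
        rw [e1, ← Finset.sum_add_distrib, ← Finset.sum_sub_distrib, Finset.mul_sum]
        refine Finset.sum_congr rfl fun i _ => ?_
        rw [← Finset.sum_add_distrib, ← Finset.sum_sub_distrib, Finset.mul_sum]
        exact Finset.sum_congr rfl fun j _ => by ring
      rw [e]
      apply mul_nonneg hr
      have e3 : ∑ x, (-∑ i, b i) * b x * |t x| ^ (2 * h) = -((∑ i, b i) * ∑ j, b j * |t j| ^ (2 * h)) := by
        rw [← neg_mul, Finset.mul_sum]
        exact Finset.sum_congr rfl fun j _ => by ring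
      have e4 : ∑ x, (b x * (-∑ i, b i) * |t x| ^ (2 * h) + ∑ y, b x * b y * |t x - t y| ^ (2 * h))
          = -((∑ i, b i) * ∑ j, b j * |t j| ^ (2 * h)) + ∑ x, ∑ y, b x * b y * |t x - t y| ^ (2 * h) := by
        rw [Finset.sum_add_distrib, ← e3]
        congr 1
        exact Finset.sum_congr rfl fun j _ => by ring
      rw [e3, e4] at this
      linarith) a
  refine this.trans_eq (Finset.sum_congr rfl fun i _ => Finset.sum_congr rfl fun j _ => ?_)
  congr 2; ring

lemma schur_test (W : ι → ι → ℝ) (hW : ∀ i j, W i j = W j i) (h0 : ∀ i j, 0 ≤ W i j) (s : ℝ)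
    (hs : ∀ i, ∑ j, W i j ≤ s) (a : ι → ℝ) :
    ∑ i, ∑ j, |a i| * |a j| * W i j ≤ s * ∑ i, a i ^ 2 := by
  have h1 : ∑ i, ∑ j, |a i| * |a j| * W i j ≤ ∑ i, ∑ j, (a i ^ 2 / 2 * W i j + a j ^ 2 / 2 * W i j) := by
    refine Finset.sum_le_sum fun i _ => Finset.sum_le_sum fun j _ => ?_
    rw [← add_mul]
    apply mul_le_mul_of_nonneg_right _ (h0 i j)
    have := sq_nonneg (|a i| - |a j|)
    rw [← sq_abs (a i), ← sq_abs (a j)]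
    nlinarith
  have h2 : ∑ i, ∑ j, a j ^ 2 / 2 * W i j = ∑ i, ∑ j, a i ^ 2 / 2 * W i j := by
    rw [Finset.sum_comm]
    exact Finset.sum_congr rfl fun i _ => Finset.sum_congr rfl fun j _ => by rw [hW]
  simp only [Finset.sum_add_distrib] at h1
  rw [h2] at h1
  have h3 : ∑ i, ∑ j, a i ^ 2 / 2 * W i j ≤ ∑ i, a i ^ 2 / 2 * s := by
    refine Finset.sum_le_sum fun i _ => ?_
    rw [← Finset.mul_sum]
    exact mul_le_mul_of_nonneg_left (hs i) (by positivity)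
  have h4 : ∑ i, a i ^ 2 / 2 * s = s * (∑ i, a i ^ 2) / 2 := by
    rw [Finset.mul_sum, Finset.sum_div]
    exact Finset.sum_congr rfl fun i _ => by ring
  linarith

end

lemma dist_sum_le (g : ℕ → ℝ) (hg : Summable g) (h0 : ∀ k, 0 ≤ g k) (N i : ℕ) :
    ∑ j ∈ Finset.range N, g ((i - j) + (j - i)) ≤ 2 * ∑' k, g k := by
  have hinj : ∀ (s : Finset ℕ) (f : ℕ → ℕ), Set.InjOn f s → ∑ j ∈ s, g (f j) ≤ ∑' k, g k := by
    intro s f hf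
    rw [← Finset.sum_image (f := g) (by simpa using hf)]
    exact hg.sum_le_tsum _ fun k _ => h0 k
  rw [← Finset.sum_filter_add_sum_filter_not _ (fun j => j ≤ i), two_mul]
  apply add_le_add
  · apply hinj
    intro x hx y hy hxy
    simp at hx hy hxy
    omega
  · apply hinj
    intro x hx y hy hxy
    simp at hx hy hxy
    omega

lemma summable_exp_neg_rpow {h : ℝ} (h0 : 0 < h) :
    Summable fun k : ℕ => Real.exp (-((k:ℝ) ^ (2 * h))) := by
  obtain ⟨m, hm⟩ := exists_nat_ge (1 / h)
  have hm2 : (2:ℝ) ≤ 2 * h * m := by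
    rw [div_le_iff₀ h0] at hm; linarith
  have hs : Summable fun k : ℕ => (m.factorial : ℝ) * (1 / (k:ℝ) ^ 2) :=
    (Real.summable_one_div_nat_pow.2 (by norm_num)).mul_left _
  rw [← summable_nat_add_iff 1] at hs ⊢
  refine Summable.of_nonneg_of_le (fun k => (Real.exp_pos _).le) (fun k => ?_) hs
  have hk : (1:ℝ) ≤ ((k + 1 : ℕ) : ℝ) := by push_cast; linarith [Nat.cast_nonneg (α := ℝ) k]
  set x : ℝ := ((k + 1 : ℕ) : ℝ)
  have hx0 : 0 < x := by linarith
  have hy : 0 < x ^ (2 * h) := Real.rpow_pos_of_pos hx0 _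
  have h1 := Real.pow_div_factorial_le_exp (x ^ (2 * h)) hy.le m
  have h2 : x ^ 2 ≤ (x ^ (2 * h)) ^ m := by
    rw [← Real.rpow_natCast (x ^ (2 * h)) m, ← Real.rpow_mul hx0.le, ← Real.rpow_natCast x 2]
    exact Real.rpow_le_rpow_of_exponent_le hk (by exact_mod_cast hm2)
  rw [Real.exp_neg]
  have hf : (0:ℝ) < m.factorial := by positivity
  have h3 : x ^ 2 / m.factorial ≤ Real.exp (x ^ (2 * h)) :=
    (div_le_div_of_nonneg_right h2 hf.le).trans h1
  calc (Real.exp (x ^ (2 * h)))⁻¹ ≤ (x ^ 2 / m.factorial)⁻¹ :=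
        inv_anti₀ (by positivity) h3
    _ = _ := by rw [inv_div]; ring

/-- Diagonal dominance of the stable kernel on a grid. -/
lemma stable_kernel_lower {h : ℝ} (h0 : 0 < h) : ∃ A : ℝ, 1 ≤ A ∧ ∀ (n : ℕ), 1 ≤ n → ∀ r : ℝ,
    A * (n:ℝ) ^ (2 * h) ≤ r → ∀ a : Fin (n + 1) → ℝ,
    (1 / 2) * ∑ i, a i ^ 2 ≤
      ∑ i, ∑ j, a i * a j * Real.exp (-(|((i:ℕ):ℝ) / n - ((j:ℕ):ℝ) / n| ^ (2 * h) * r)) := by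
  have hsum := summable_exp_neg_rpow h0
  set S := ∑' k : ℕ, Real.exp (-((k:ℝ) ^ (2 * h))) with hS
  have hS0 : 0 ≤ S := tsum_nonneg fun k => (Real.exp_pos _).le
  refine ⟨1 + Real.log (4 * (S + 1)), ?_, ?_⟩
  · have : 0 ≤ Real.log (4 * (S + 1)) := Real.log_nonneg (by linarith)
    linarith
  intro n hn r hr a
  have hn0 : (0:ℝ) < n := by exact_mod_cast hn
  set c : ℝ := Real.exp (-Real.log (4 * (S + 1))) with hc
  have hc' : c = 1 / (4 * (S + 1)) := by
    rw [hc, Real.exp_neg, Real.exp_log (by linarith), one_div]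
  have hc0 : 0 < c := Real.exp_pos _
  set W : Fin (n+1) → Fin (n+1) → ℝ := fun i j => if i = j then 0 else
    Real.exp (-(|((i:ℕ):ℝ) / n - ((j:ℕ):ℝ) / n| ^ (2 * h) * r)) with hW
  have hWle : ∀ i j : Fin (n+1), W i j ≤
      c * Real.exp (-((((i:ℕ) - (j:ℕ)) + ((j:ℕ) - (i:ℕ)) : ℕ) : ℝ) ^ (2 * h)) := by
    intro i j
    by_cases hij : i = j
    · simp only [hW, hij, if_true]; positivity
    · simp only [hW, hij, if_false]
      rw [hc, ← Real.exp_add, Real.exp_le_exp]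
      set d : ℕ := ((i:ℕ) - (j:ℕ)) + ((j:ℕ) - (i:ℕ)) with hd
      have hd1 : 1 ≤ d := by
        have : (i:ℕ) ≠ j := fun h => hij (Fin.ext h)
        omega
      have hdabs : |((i:ℕ):ℝ) / n - ((j:ℕ):ℝ) / n| = (d:ℝ) / n := by
        rw [← sub_div, abs_div, abs_of_pos hn0]
        congr 1
        rcases le_total (i:ℕ) (j:ℕ) with hle | hle
        · have : d = (j:ℕ) - i := by omega
          rw [this, Nat.cast_sub hle, abs_sub_comm, abs_of_nonneg]
          simpa using hle
        · have : d = (i:ℕ) - j := by omega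
          rw [this, Nat.cast_sub hle, abs_of_nonneg]
          simpa using hle
      rw [hdabs, Real.div_rpow (by positivity) hn0.le]
      have hdp : (1:ℝ) ≤ (d:ℝ) ^ (2 * h) := Real.one_le_rpow (by exact_mod_cast hd1) (by positivity)
      have hnp : (0:ℝ) < (n:ℝ) ^ (2 * h) := Real.rpow_pos_of_pos hn0 _
      have hl : 0 ≤ Real.log (4 * (S + 1)) := Real.log_nonneg (by linarith)
      have : (d:ℝ) ^ (2 * h) * (1 + Real.log (4 * (S + 1))) ≤ (d:ℝ) ^ (2 * h) / (n:ℝ) ^ (2 * h) * r := by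
        rw [div_mul_eq_mul_div, le_div_iff₀ hnp, mul_assoc]
        exact mul_le_mul_of_nonneg_left hr (by positivity)
      have h2 : Real.log (4 * (S + 1)) ≤ (d:ℝ) ^ (2 * h) * Real.log (4 * (S + 1)) :=
        le_mul_of_one_le_left hl hdp
      linarith
  have hrow : ∀ i, ∑ j, W i j ≤ 1 / 2 := by
    intro i
    calc ∑ j, W i j ≤ ∑ j : Fin (n+1),
          c * Real.exp (-((((i:ℕ) - (j:ℕ)) + ((j:ℕ) - (i:ℕ)) : ℕ) : ℝ) ^ (2 * h)) :=
          Finset.sum_le_sum fun j _ => hWle i j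
      _ = c * ∑ j ∈ Finset.range (n+1),
          Real.exp (-((((i:ℕ) - j) + (j - (i:ℕ)) : ℕ) : ℝ) ^ (2 * h)) := by
          rw [← Finset.mul_sum, Finset.sum_range]
      _ ≤ c * (2 * S) := by
          apply mul_le_mul_of_nonneg_left _ hc0.le
          exact dist_sum_le (fun k : ℕ => Real.exp (-((k:ℝ) ^ (2 * h)))) hsum
            (fun k => (Real.exp_pos _).le) (n+1) i
      _ ≤ 1 / 2 := by
          rw [hc', one_div_mul_eq_div, div_le_div_iff₀ (by linarith) (by norm_num)]
          linarith
  have hst := schur_test W (fun i j => by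
      simp only [hW, eq_comm, abs_sub_comm]) (fun i j => by
      simp only [hW]; split_ifs
      · exact le_rfl
      · exact (Real.exp_pos _).le) (1/2) hrow a
  have hdec : ∑ i, ∑ j, a i * a j * Real.exp (-(|((i:ℕ):ℝ) / n - ((j:ℕ):ℝ) / n| ^ (2 * h) * r))
      = ∑ i, a i ^ 2 + ∑ i, ∑ j, a i * a j * W i j := by
    rw [← Finset.sum_add_distrib]
    refine Finset.sum_congr rfl fun i _ => ?_
    have : a i ^ 2 = ∑ j, if i = j then a i * a j else 0 := by simp [sq]
    rw [this, ← Finset.sum_add_distrib]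
    refine Finset.sum_congr rfl fun j _ => ?_
    by_cases hij : i = j
    · subst hij; simp [hW, Real.zero_rpow (show 2 * h ≠ 0 by positivity)]
    · simp [hW, hij]
  have hlow : -(∑ i, ∑ j, |a i| * |a j| * W i j) ≤ ∑ i, ∑ j, a i * a j * W i j := by
    rw [← Finset.sum_neg_distrib]
    refine Finset.sum_le_sum fun i _ => ?_
    rw [← Finset.sum_neg_distrib]
    refine Finset.sum_le_sum fun j _ => ?_
    rw [← neg_mul]
    apply mul_le_mul_of_nonneg_right
    · rw [← abs_mul]; exact neg_abs_le _
    · simp only [hW]; split_ifs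
      · exact le_rfl
      · exact (Real.exp_pos _).le
  rw [hdec]
  linarith

end BifSB

namespace BifSB

lemma laplace_lower {K : ℝ} (h0 : 0 < K) (h1 : K < 1) {σ : Type*} [Fintype σ] (c x : σ → ℝ)
    (hx : ∀ i, 0 ≤ x i) (R m : ℝ) (hR : 0 < R)
    (hD : ∀ r, 0 < r → 0 ≤ ∑ i, c i * (1 - Real.exp (-(x i * r))))
    (hm : ∀ r, R ≤ r → m ≤ ∑ i, c i * (1 - Real.exp (-(x i * r)))) :
    m * (R ^ (-K) / K) ≤ cpow K * ∑ i, c i * x i ^ K := by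
  rw [← sum_pow_integral h0 h1 c x hx]
  have hintg := sum_pow_integrable h0 h1 c x hx
  have hsub : Set.Ioi R ⊆ Set.Ioi (0:ℝ) := Set.Ioi_subset_Ioi hR.le
  have e1 := setIntegral_mono_set hintg
    ((ae_restrict_iff' measurableSet_Ioi).2 (Filter.Eventually.of_forall fun r hr =>
      mul_nonneg (hD r hr) (Real.rpow_nonneg (le_of_lt hr) _))) (ae_of_all _ hsub)
  refine le_trans ?_ e1
  have e2 : m * (R ^ (-K) / K) = ∫ r in Set.Ioi R, m * r ^ (-1 - K) := by
    rw [integral_const_mul, integral_Ioi_rpow_of_lt (by linarith) hR]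
    congr 1
    rw [show (-1 - K + 1) = -K by ring]
    field_simp
  rw [e2]
  apply setIntegral_mono_on
  · exact (integrableOn_Ioi_rpow_of_lt (by linarith) hR).const_mul m
  · exact hintg.mono_set hsub
  · exact measurableSet_Ioi
  · intro r hr
    have hr' : R < r := hr
    exact mul_le_mul_of_nonneg_right (hm r hr'.le) (Real.rpow_nonneg (hR.trans hr').le _)

lemma laplace_lower_double {K : ℝ} (h0 : 0 < K) (h1 : K < 1) {ι : Type*} [Fintype ι]
    (b : ι → ι → ℝ) (s : Fin 3 → ℝ) (x : Fin 3 → ι → ι → ℝ)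
    (hx : ∀ k i j, 0 ≤ x k i j) (R m : ℝ) (hR : 0 < R)
    (hD : ∀ r, 0 < r → 0 ≤ ∑ i, ∑ j, b i j * ∑ k, s k * (1 - Real.exp (-(x k i j * r))))
    (hm : ∀ r, R ≤ r → m ≤ ∑ i, ∑ j, b i j * ∑ k, s k * (1 - Real.exp (-(x k i j * r)))) :
    m * (R ^ (-K) / K) ≤ cpow K * ∑ i, ∑ j, b i j * ∑ k, s k * x k i j ^ K := by
  have := laplace_lower h0 h1 (σ := ι × ι × Fin 3) (fun p => b p.1 p.2.1 * s p.2.2)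
    (fun p => x p.2.2 p.1 p.2.1) (fun p => hx _ _ _) R m hR
  simp only [Fintype.sum_prod_type, mul_assoc, ← Finset.mul_sum] at this
  exact this hD hm

lemma cons_form {n : ℕ} (E : Fin (n+1) → Fin (n+1) → ℝ) (hE : ∀ i j, E i j = E j i) (a0 : ℝ) (a : Fin n → ℝ) :
    ∑ i, ∑ j, (Fin.cons a0 a : Fin (n+1) → ℝ) i * (Fin.cons a0 a : Fin (n+1) → ℝ) j * E i j
    = a0^2 * E 0 0 + 2 * a0 * ∑ j, a j * E 0 j.succ + ∑ i, ∑ j, a i * a j * E i.succ j.succ := by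
  simp only [Fin.sum_univ_succ, Fin.cons_zero, Fin.cons_succ]
  rw [Finset.sum_add_distrib]
  have : ∑ i : Fin n, a i * a0 * E i.succ 0 = a0 * ∑ j, a j * E 0 j.succ := by
    rw [Finset.mul_sum]
    exact Finset.sum_congr rfl fun i _ => by rw [hE]; ring
  have e2 : ∑ i : Fin n, a0 * a i * E 0 i.succ = a0 * ∑ j, a j * E 0 j.succ := by
    rw [Finset.mul_sum]
    exact Finset.sum_congr rfl fun i _ => by ring
  rw [this, e2]; ring

lemma Q_lower {H K : ℝ} (hH : H ∈ Set.Ioo (0:ℝ) 1) (hK : K ∈ Set.Ioc (0:ℝ) 1) :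
    ∃ c : ℝ, 0 < c ∧ ∀ n : ℕ, 1 ≤ n → ∀ a : Fin n → ℝ,
      c * (n:ℝ) ^ (-(2 * (H * K))) * ∑ i, a i ^ 2 ≤
        ∑ i, ∑ j, a i * a j * Rbif H K (((i:ℕ) + 1 : ℝ) / n) (((j:ℕ) + 1 : ℝ) / n) := by
  obtain ⟨hH0, hH1⟩ := hH
  obtain ⟨hK0, hK1⟩ := hK
  rcases hK1.eq_or_lt with rfl | hK1
  · -- K = 1
    obtain ⟨A, hA1, hA⟩ := stable_kernel_lower (h := 1) one_pos
    have hA0 : 0 < A := by linarith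
    have hc := cpow_pos hH0 hH1
    refine ⟨(1/2) * (cpow H)⁻¹ * ((1/2) * (A ^ (-H) / H)), by positivity, ?_⟩
    intro n hn a
    have hn0 : (0:ℝ) < n := by exact_mod_cast hn
    have key := laplace_lower_double hH0 hH1 (ι := Fin n) (fun i j => a i * a j) ![1, 1, -1]
      ![fun i _ => (((i:ℕ) + 1 : ℝ) / n) ^ 2, fun _ j => (((j:ℕ) + 1 : ℝ) / n) ^ 2,
        fun i j => (((i:ℕ) + 1 : ℝ) / n - ((j:ℕ) + 1 : ℝ) / n) ^ 2]
      (by intro k i j; fin_cases k <;> simp <;> positivity) (A * (n:ℝ) ^ (2 * (1:ℝ)))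
      ((1/2) * ∑ i, a i ^ 2) (by positivity)
    have hform : ∀ r : ℝ, ∑ i, ∑ j, (fun i j => a i * a j) i j * ∑ k, (![1, 1, -1] : Fin 3 → ℝ) k * (1 - Real.exp (-(
        (![fun i _ => (((i:ℕ) + 1 : ℝ) / n) ^ 2, fun _ j => (((j:ℕ) + 1 : ℝ) / n) ^ 2,
        fun i j => (((i:ℕ) + 1 : ℝ) / n - ((j:ℕ) + 1 : ℝ) / n) ^ 2] : Fin 3 → Fin n → Fin n → ℝ) k i j * r)))
        = ∑ i, ∑ j, (Fin.cons (-∑ i, a i) a : Fin (n+1) → ℝ) i * (Fin.cons (-∑ i, a i) a : Fin (n+1) → ℝ) j *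
          Real.exp (-(|((i:ℕ):ℝ) / n - ((j:ℕ):ℝ) / n| ^ (2 * (1:ℝ)) * r)) := by
      intro r
      rw [cons_form (fun i j : Fin (n+1) => Real.exp (-(|((i:ℕ):ℝ) / n - ((j:ℕ):ℝ) / n| ^ (2 * (1:ℝ)) * r)))
        (fun i j => by rw [abs_sub_comm])]
      simp only [abs_rpow_two_mul, Real.rpow_one, Fin.sum_univ_three, Fin.val_succ, Fin.val_zero]
      simp only [Matrix.cons_val_zero, Matrix.cons_val_one, Matrix.cons_val]
      push_cast
      simp only [zero_div, sub_zero, zero_sub, neg_sq, zero_pow two_ne_zero, ne_eq, OfNat.ofNat_ne_zero,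
        not_false_eq_true, zero_mul, neg_zero, Real.exp_zero]
      set e : Fin n → ℝ := fun i => Real.exp (-((((i:ℕ) + 1 : ℝ) / n) ^ 2 * r)) with he
      have t1 : (∑ i, a i)^2 * 1 = ∑ i, ∑ j, a i * a j := by
        rw [sq, Finset.sum_mul_sum]; simp
      have t2 : 2 * (-∑ i, a i) * (∑ j, a j * e j) = -∑ i, ∑ j, a i * a j * e j - ∑ i, ∑ j, a i * a j * e i := by
        have : ∑ i, ∑ j, a i * a j * e i = ∑ i, ∑ j, a i * a j * e j := by
          rw [Finset.sum_comm]
          exact Finset.sum_congr rfl fun i _ => Finset.sum_congr rfl fun j _ => by ring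
        rw [this, mul_assoc, neg_mul, Finset.sum_mul_sum]
        simp only [mul_assoc]; ring
      rw [t1, t2]
      simp only [← Finset.sum_neg_distrib, ← Finset.sum_sub_distrib, ← Finset.sum_add_distrib]
      refine Finset.sum_congr rfl fun i _ => Finset.sum_congr rfl fun j _ => ?_
      ring
    have key2 := key (fun r hr => by rw [hform]; exact stable_kernel (fun i : Fin (n+1) => ((i:ℕ):ℝ)/n) one_pos le_rfl hr.le _)
      (fun r hr => by
        rw [hform]
        refine le_trans ?_ (hA n hn r hr _)
        rw [Fin.sum_univ_succ]
        simp only [Fin.cons_zero, Fin.cons_succ]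
        nlinarith [sq_nonneg (-∑ i, a i)])
    have hQ : ∑ i, ∑ j, a i * a j * Rbif H 1 (((i:ℕ) + 1 : ℝ) / n) (((j:ℕ) + 1 : ℝ) / n) =
       (1/2) * ∑ i, ∑ j, (fun i j => a i * a j) i j * ∑ k, (![1, 1, -1] : Fin 3 → ℝ) k * 
        (![fun i _ => (((i:ℕ) + 1 : ℝ) / n) ^ 2, fun _ j => (((j:ℕ) + 1 : ℝ) / n) ^ 2,
        fun i j => (((i:ℕ) + 1 : ℝ) / n - ((j:ℕ) + 1 : ℝ) / n) ^ 2] : Fin 3 → Fin n → Fin n → ℝ) k i j ^ H := by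
      rw [Finset.mul_sum]
      refine Finset.sum_congr rfl fun i _ => ?_
      rw [Finset.mul_sum]
      refine Finset.sum_congr rfl fun j _ => ?_
      simp only [Rbif, Fin.sum_univ_three, Matrix.cons_val_zero, Matrix.cons_val_one, Matrix.cons_val, Real.rpow_one, mul_one]
      rw [← abs_rpow_two_mul, ← abs_rpow_two_mul, ← abs_rpow_two_mul, abs_sub_comm,
        abs_of_nonneg (a := ((i:ℕ) + 1 : ℝ) / n) (by positivity), abs_of_nonneg (a := ((j:ℕ) + 1 : ℝ) / n) (by positivity), Real.rpow_neg_one]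
      ring
    rw [hQ]
    have hpw : (A * (n:ℝ) ^ (2 * (1:ℝ))) ^ (-H) = A ^ (-H) * (n:ℝ) ^ (-(2 * (H * 1))) := by
      rw [Real.mul_rpow hA0.le (by positivity), ← Real.rpow_mul hn0.le]
      congr 2; ring
    rw [hpw] at key2
    have key3 := mul_le_mul_of_nonneg_left key2 (inv_nonneg.2 hc.le)
    rw [← mul_assoc (cpow H)⁻¹ (cpow H), inv_mul_cancel₀ hc.ne', one_mul] at key3
    refine le_trans (le_of_eq ?_) (mul_le_mul_of_nonneg_left key3 (by norm_num : (0:ℝ) ≤ 1/2))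
    ring
  · -- K < 1
    obtain ⟨A, hA1, hA⟩ := stable_kernel_lower (h := H) hH0
    have hA0 : 0 < A := by linarith
    have hc := cpow_pos hK0 hK1
    refine ⟨(2:ℝ)^(-K) * (cpow K)⁻¹ * ((1/2) * (A ^ (-K) / K)), by positivity, ?_⟩
    intro n hn a
    have hn0 : (0:ℝ) < n := by exact_mod_cast hn
    have key := laplace_lower_double hK0 hK1 (ι := Fin n) (fun i j => a i * a j) ![1, 0, -1]
      ![fun i j => (((j:ℕ) + 1 : ℝ) / n) ^ (2 * H) + (((i:ℕ) + 1 : ℝ) / n) ^ (2 * H), fun _ j => 0,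
        fun i j => |((i:ℕ) + 1 : ℝ) / n - ((j:ℕ) + 1 : ℝ) / n| ^ (2 * H)]
      (by intro k i j; fin_cases k <;> simp <;> positivity) (A * (n:ℝ) ^ (2 * H))
      ((1/2) * ∑ i, a i ^ 2) (by positivity)
    have hform : ∀ r : ℝ, ∃ a0 : ℝ, ∑ i, ∑ j, (fun i j => a i * a j) i j * ∑ k, (![1, 0, -1] : Fin 3 → ℝ) k * (1 - Real.exp (-(
        (![fun i j => (((j:ℕ) + 1 : ℝ) / n) ^ (2 * H) + (((i:ℕ) + 1 : ℝ) / n) ^ (2 * H), fun _ j => 0,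
        fun i j => |((i:ℕ) + 1 : ℝ) / n - ((j:ℕ) + 1 : ℝ) / n| ^ (2 * H)] : Fin 3 → Fin n → Fin n → ℝ) k i j * r)))
        = ∑ i, ∑ j, (Fin.cons a0 a : Fin (n+1) → ℝ) i * (Fin.cons a0 a : Fin (n+1) → ℝ) j *
          Real.exp (-(|((i:ℕ):ℝ) / n - ((j:ℕ):ℝ) / n| ^ (2 * H) * r)) := by
      intro r
      set e : Fin n → ℝ := fun i => Real.exp (-((((i:ℕ) + 1 : ℝ) / n) ^ (2 * H) * r)) with he
      refine ⟨-∑ i, a i * e i, ?_⟩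
      rw [cons_form (fun i j : Fin (n+1) => Real.exp (-(|((i:ℕ):ℝ) / n - ((j:ℕ):ℝ) / n| ^ (2 * H) * r)))
        (fun i j => by rw [abs_sub_comm])]
      simp only [Fin.sum_univ_three, Fin.val_succ, Fin.val_zero]
      simp only [Matrix.cons_val_zero, Matrix.cons_val_one, Matrix.cons_val]
      push_cast
      have h2H : 2 * H ≠ 0 := by positivity
      have hab : ∀ j : Fin n, |((j:ℕ) + 1 : ℝ) / n| = ((j:ℕ) + 1 : ℝ) / n := fun j => abs_of_nonneg (by positivity)
      simp only [zero_div, sub_zero, zero_sub, abs_neg, hab, abs_zero, Real.zero_rpow h2H,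
        zero_mul, neg_zero, Real.exp_zero, add_zero]
      have t1 : (-∑ i, a i * e i)^2 * 1 + 2 * (-∑ i, a i * e i) * (∑ j, a j * e j)= -∑ i, ∑ j, a i * a j * (e i * e j) := by
        have : ∑ i, ∑ j, a i * a j * (e i * e j) = (∑ i, a i * e i) * (∑ i, a i * e i) := by
          rw [Finset.sum_mul_sum]
          exact Finset.sum_congr rfl fun i _ => Finset.sum_congr rfl fun j _ => by ring
        rw [this]; ring
      rw [t1]
      simp only [← Finset.sum_neg_distrib, ← Finset.sum_sub_distrib, ← Finset.sum_add_distrib]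
      refine Finset.sum_congr rfl fun i _ => Finset.sum_congr rfl fun j _ => ?_
      rw [he]; beta_reduce
      rw [← Real.exp_add, show -(((((j:ℕ) + 1 : ℝ) / n) ^ (2 * H) + (((i:ℕ) + 1 : ℝ) / n) ^ (2 * H)) * r) = -((((i:ℕ) + 1 : ℝ) / n) ^ (2 * H) * r) + -((((j:ℕ) + 1 : ℝ) / n) ^ (2 * H) * r) by ring] <;> ring
    have key2 := key (fun r hr => by
        obtain ⟨a0, h⟩ := hform r
        rw [h]; exact stable_kernel (fun i : Fin (n+1) => ((i:ℕ):ℝ)/n) hH0 hH1.le hr.le _)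
      (fun r hr => by
        obtain ⟨a0, h⟩ := hform r
        rw [h]
        refine le_trans ?_ (hA n hn r hr _)
        rw [Fin.sum_univ_succ]
        simp only [Fin.cons_zero, Fin.cons_succ]
        nlinarith [sq_nonneg a0])
    have hQ : ∑ i, ∑ j, a i * a j * Rbif H K (((i:ℕ) + 1 : ℝ) / n) (((j:ℕ) + 1 : ℝ) / n) =
       (2:ℝ)^(-K) * ∑ i, ∑ j, (fun i j => a i * a j) i j * ∑ k, (![1, 0, -1] : Fin 3 → ℝ) k * 
        (![fun i j => (((j:ℕ) + 1 : ℝ) / n) ^ (2 * H) + (((i:ℕ) + 1 : ℝ) / n) ^ (2 * H), fun _ j => 0,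
        fun i j => |((i:ℕ) + 1 : ℝ) / n - ((j:ℕ) + 1 : ℝ) / n| ^ (2 * H)] : Fin 3 → Fin n → Fin n → ℝ) k i j ^ K := by
      rw [Finset.mul_sum]
      refine Finset.sum_congr rfl fun i _ => ?_
      rw [Finset.mul_sum]
      refine Finset.sum_congr rfl fun j _ => ?_
      simp only [Rbif, Fin.sum_univ_three, Matrix.cons_val_zero, Matrix.cons_val_one, Matrix.cons_val]
      rw [abs_sub_comm, Real.rpow_mul (abs_nonneg _)]
      ring
    rw [hQ]
    have hpw : (A * (n:ℝ) ^ (2 * H)) ^ (-K) = A ^ (-K) * (n:ℝ) ^ (-(2 * (H * K))) := by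
      rw [Real.mul_rpow hA0.le (by positivity), ← Real.rpow_mul hn0.le]
      congr 2; ring
    rw [hpw] at key2
    have key3 := mul_le_mul_of_nonneg_left key2 (inv_nonneg.2 hc.le)
    rw [← mul_assoc (cpow K)⁻¹ (cpow K), inv_mul_cancel₀ hc.ne', one_mul] at key3
    refine le_trans (le_of_eq ?_) (mul_le_mul_of_nonneg_left key3 (by positivity : (0:ℝ) ≤ 2^(-K)))
    ring

end BifSB

namespace BifSB

lemma Rbif_symm (H K s t : ℝ) : Rbif H K s t = Rbif H K t s := by
  unfold Rbif; rw [abs_sub_comm, add_comm]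

lemma Rbif_nonneg {H K : ℝ} (hH : 0 < H) (hK : 0 < K) {s t : ℝ} (hs : 0 ≤ s) (ht : 0 ≤ t) :
    0 ≤ Rbif H K s t := by
  unfold Rbif
  apply mul_nonneg (by positivity)
  rw [Real.rpow_mul (abs_nonneg _), sub_nonneg]
  apply Real.rpow_le_rpow (by positivity) _ hK.le
  rcases le_total s t with h | h
  · rw [abs_of_nonneg (by linarith)]
    have := Real.rpow_le_rpow (by linarith) (show t - s ≤ t by linarith) (show 0 ≤ 2 * H by linarith)
    have := Real.rpow_nonneg hs (2 * H)
    linarith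
  · rw [abs_sub_comm, abs_of_nonneg (by linarith)]
    have := Real.rpow_le_rpow (by linarith) (show s - t ≤ s by linarith) (show 0 ≤ 2 * H by linarith)
    have := Real.rpow_nonneg ht (2 * H)
    linarith

section
variable {Ω : Type*} [MeasurableSpace Ω] {μ : Measure Ω} {H K : ℝ}
  {B : ℝ → Ω → ℝ}

lemma comb_law (hB : IsBifBM μ H K B) {κ : Type*} [Fintype κ] (t : κ → ℝ) (ht : ∀ i, 0 ≤ t i) (a : κ → ℝ) :
    Measure.map (fun ω => ∑ i, a i * B (t i) ω) μ =
      gaussianReal 0 (Real.toNNReal (∑ i, ∑ j, a i * a j * Rbif H K (t i) (t j))) := by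
  have e := (Fintype.equivFin κ).symm
  have := hB.2 _ (fun i => t (e i)) (fun i => ht _) (fun i => a (e i))
  have h1 : ∀ ω, ∑ i, a (e i) * B (t (e i)) ω = ∑ i, a i * B (t i) ω := fun ω =>
    e.sum_comp (fun i => a i * B (t i) ω)
  have h2 : ∑ i, ∑ j, a (e i) * a (e j) * Rbif H K (t (e i)) (t (e j)) = ∑ i, ∑ j, a i * a j * Rbif H K (t i) (t j) := by
    rw [← e.sum_comp]
    exact Finset.sum_congr rfl fun i _ => e.sum_comp (fun j => a (e i) * a j * Rbif H K (t (e i)) (t j))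
  simp only [h1, h2] at this
  exact this

lemma comb_aem (hB : IsBifBM μ H K B) {κ : Type*} [Fintype κ] (t : κ → ℝ) (ht : ∀ i, 0 ≤ t i) (a : κ → ℝ) :
    AEMeasurable (fun ω => ∑ i, a i * B (t i) ω) μ :=
  aemeasurable_of_map_neZero (by rw [comb_law hB t ht a]; infer_instance)

lemma one_law (hB : IsBifBM μ H K B) {t : ℝ} (ht : 0 ≤ t) :
    Measure.map (B t) μ = gaussianReal 0 (Real.toNNReal (Rbif H K t t)) := by
  have := comb_law hB (κ := Unit) (fun _ => t) (fun _ => ht) (fun _ => 1)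
  simpa using this

lemma one_aem (hB : IsBifBM μ H K B) {t : ℝ} (ht : 0 ≤ t) : AEMeasurable (B t) μ :=
  aemeasurable_of_map_neZero (by rw [one_law hB ht]; infer_instance)

lemma B_zero (hB : IsBifBM μ H K B) (hH : 0 < H) (hK : 0 < K) : ∀ᵐ ω ∂μ, B 0 ω = 0 := by
  have h := one_law hB le_rfl
  have h0 : Rbif H K 0 0 = 0 := by
    unfold Rbif
    rw [sub_self, abs_zero, Real.zero_rpow (by positivity), Real.zero_rpow (by positivity), add_zero,
      Real.zero_rpow hK.ne']
    simp
  rw [h0, Real.toNNReal_zero, gaussianReal_zero_var] at h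
  have : ∀ᵐ y ∂(Measure.map (B 0) μ), y = 0 := by
    rw [h]; exact (ae_dirac_iff (p := fun y : ℝ => y = 0) (measurableSet_singleton (0:ℝ))).2 rfl
  exact ae_of_ae_map (one_aem hB le_rfl) this

lemma gauss_second (v : NNReal) : ∫ y, y ^ 2 ∂(gaussianReal 0 v) = v := by
  have := variance_fun_id_gaussianReal (μ := 0) (v := v)
  rw [variance_of_integral_eq_zero aemeasurable_id' (by simp)] at this
  exact this

lemma comb_second (hB : IsBifBM μ H K B) {κ : Type*} [Fintype κ] (t : κ → ℝ) (ht : ∀ i, 0 ≤ t i) (a : κ → ℝ) :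
    ∫ ω, (∑ i, a i * B (t i) ω) ^ 2 ∂μ = Real.toNNReal (∑ i, ∑ j, a i * a j * Rbif H K (t i) (t j)) := by
  rw [← gauss_second, ← comb_law hB t ht a, integral_map (comb_aem hB t ht a)
    (by fun_prop)]

lemma one_memLp (hB : IsBifBM μ H K B) {t : ℝ} (ht : 0 ≤ t) : MemLp (B t) 2 μ := by
  have := memLp_id_gaussianReal' (μ := 0) (v := Real.toNNReal (Rbif H K t t)) 2 (by simp)
  rw [← one_law hB ht] at this
  exact (memLp_map_measure_iff (by fun_prop) (one_aem hB ht)).1 this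

lemma cov_eq (hB : IsBifBM μ H K B) (hH : 0 < H) (hK : 0 < K) {s t : ℝ} (hs : 0 ≤ s) (ht : 0 ≤ t) :
    ∫ ω, B s ω * B t ω ∂μ = Rbif H K s t := by
  have hst := Rbif_nonneg hH hK hs ht
  have hss := Rbif_nonneg hH hK hs hs
  have htt := Rbif_nonneg hH hK ht ht
  have h2 := comb_second hB (κ := Fin 2) ![s, t] (by intro i; fin_cases i <;> simpa) ![1, 1]
  have h1s := comb_second hB (κ := Unit) (fun _ => s) (fun _ => hs) (fun _ => 1)
  have h1t := comb_second hB (κ := Unit) (fun _ => t) (fun _ => ht) (fun _ => 1)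
  simp [Fin.sum_univ_two] at h2 h1s h1t
  rw [Rbif_symm H K t s, max_eq_left (by linarith)] at h2
  rw [max_eq_left hss] at h1s
  rw [max_eq_left htt] at h1t
  have is := (one_memLp hB hs).integrable_sq
  have it := (one_memLp hB ht).integrable_sq
  have ist : Integrable (fun ω => B s ω * B t ω) μ := (one_memLp hB hs).integrable_mul (one_memLp hB ht)
  have : ∫ ω, (B s ω + B t ω)^2 ∂μ = ∫ ω, B s ω ^ 2 ∂μ + 2 * ∫ ω, B s ω * B t ω ∂μ + ∫ ω, B t ω ^ 2 ∂μ := by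
    have i2 : Integrable (fun ω => B s ω ^ 2 + 2 * (B s ω * B t ω)) μ := is.add (ist.const_mul 2)
    rw [← integral_const_mul, ← integral_add is (ist.const_mul 2), ← integral_add i2 it]
    congr 1; ext ω; ring
  rw [this] at h2
  linarith

lemma Q_nonneg (hB : IsBifBM μ H K B) (hH : 0 < H) (hK : 0 < K) {κ : Type*} [Fintype κ] (t : κ → ℝ)
    (ht : ∀ i, 0 ≤ t i) (a : κ → ℝ) : 0 ≤ ∑ i, ∑ j, a i * a j * Rbif H K (t i) (t j) := by
  have : ∑ i, ∑ j, a i * a j * Rbif H K (t i) (t j) = ∫ ω, (∑ i, a i * B (t i) ω) ^ 2 ∂μ := by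
    have hi : ∀ i j, Integrable (fun ω => a i * a j * (B (t i) ω * B (t j) ω)) μ := fun i j =>
      ((one_memLp hB (ht i)).integrable_mul (one_memLp hB (ht j))).const_mul _
    have e : ∀ ω, (∑ i, a i * B (t i) ω) ^ 2 = ∑ i, ∑ j, a i * a j * (B (t i) ω * B (t j) ω) := by
      intro ω
      rw [sq, Finset.sum_mul_sum]
      exact Finset.sum_congr rfl fun i _ => Finset.sum_congr rfl fun j _ => by ring
    simp_rw [e]
    rw [integral_finsetSum _ fun i _ => integrable_finsetSum _ fun j _ => hi i j]
    refine Finset.sum_congr rfl fun i _ => ?_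
    rw [integral_finsetSum _ fun j _ => hi i j]
    refine Finset.sum_congr rfl fun j _ => ?_
    rw [integral_const_mul, cov_eq hB hH hK (ht i) (ht j)]
  rw [this]
  exact integral_nonneg fun ω => sq_nonneg _

/-- covariance matrix of linear combinations -/
noncomputable def Scov (H K : ℝ) {ι ε : Type*} [Fintype ε] (w t : ι → ε → ℝ) (i j : ι) : ℝ :=
  ∑ e, ∑ f, w i e * w j f * Rbif H K (t i e) (t j f)

lemma Scov_symm (H K : ℝ) {ι ε : Type*} [Fintype ε] (w t : ι → ε → ℝ) (i j : ι) :
    Scov H K w t i j = Scov H K w t j i := by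
  unfold Scov
  rw [Finset.sum_comm]
  exact Finset.sum_congr rfl fun e _ => Finset.sum_congr rfl fun f _ => by rw [Rbif_symm]; ring

lemma Scov_form (H K : ℝ) {ι ε : Type*} [Fintype ε] [Fintype ι] (w t : ι → ε → ℝ) (a : ι → ℝ) :
    ∑ i, ∑ j, a i * a j * Scov H K w t i j =
    ∑ p : ι × ε, ∑ p' : ι × ε, (a p.1 * w p.1 p.2) * (a p'.1 * w p'.1 p'.2) *
      Rbif H K (t p.1 p.2) (t p'.1 p'.2) := by
  simp only [Fintype.sum_prod_type, Scov, Finset.mul_sum]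
  refine Finset.sum_congr rfl fun i _ => ?_
  rw [Finset.sum_comm]
  exact Finset.sum_congr rfl fun e _ => Finset.sum_congr rfl fun f _ => Finset.sum_congr rfl fun _ _ => by ring

lemma vec_aem (hB : IsBifBM μ H K B) {ι ε : Type*} [Fintype ι] [Fintype ε]
    (w t : ι → ε → ℝ) (ht : ∀ i e, 0 ≤ t i e) :
    AEMeasurable (fun ω (i : ι) => ∑ e, w i e * B (t i e) ω) μ :=
  aemeasurable_pi_lambda _ fun i => comb_aem hB (t i) (ht i) (w i)

lemma vec_law (hB : IsBifBM μ H K B) (hH : 0 < H) (hK : 0 < K) {ι ε : Type*} [Fintype ι] [Fintype ε]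
    (w t : ι → ε → ℝ) (ht : ∀ i e, 0 ≤ t i e) :
    GaussV (μ.map (fun ω (i : ι) => ∑ e, w i e * B (t i e) ω))
      (fun a => ∑ i, ∑ j, a i * a j * Scov H K w t i j) := by
  intro a
  rw [integral_map (vec_aem hB w t ht) (Continuous.aestronglyMeasurable (by fun_prop))]
  beta_reduce
  rw [Scov_form]
  have hl := comb_law hB (κ := ι × ε) (fun p => t p.1 p.2) (fun p => ht _ _) (fun p => a p.1 * w p.1 p.2)
  have hm := comb_aem hB (κ := ι × ε) (fun p => t p.1 p.2) (fun p => ht _ _) (fun p => a p.1 * w p.1 p.2)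
  have hq := Q_nonneg hB hH hK (κ := ι × ε) (fun p => t p.1 p.2) (fun p => ht _ _) (fun p => a p.1 * w p.1 p.2)
  set q := ∑ p : ι × ε, ∑ p' : ι × ε, (a p.1 * w p.1 p.2) * (a p'.1 * w p'.1 p'.2) *
      Rbif H K (t p.1 p.2) (t p'.1 p'.2) with hqd
  have hc := charFun_gaussianReal (μ := 0) (v := Real.toNNReal q) 1
  rw [← hl, charFun_apply_real, integral_map hm (Continuous.aestronglyMeasurable (by fun_prop))] at hc
  have e : ∀ ω, ∑ i, a i * ∑ e, w i e * B (t i e) ω = ∑ p : ι × ε, a p.1 * w p.1 p.2 * B (t p.1 p.2) ω := by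
    intro ω
    simp only [Fintype.sum_prod_type, Finset.mul_sum, mul_assoc]
  simp_rw [e]
  simp only [Complex.ofReal_one, one_mul] at hc
  rw [hc]
  congr 1
  rw [Real.coe_toNNReal _ hq]
  push_cast
  ring

end
end BifSB

namespace BifSB

section
variable {Ω : Type*} [MeasurableSpace Ω] {μ : Measure Ω} [IsProbabilityMeasure μ] {H K : ℝ}
  {B : ℝ → Ω → ℝ}

lemma event_sub {ω : Ω} (hc : ContinuousOn (fun t => B t ω) (Set.Ici 0)) (h0 : B 0 ω = 0) {t₀ x : ℝ}
    (ht₀ : t₀ ∈ Set.Icc (0:ℝ) 1)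
    (h : (⨆ t : Set.Icc (0:ℝ) 1, |B t ω - B t₀ ω|) ≤ x) {s : ℝ} (hs : s ∈ Set.Icc (0:ℝ) 1) :
    |B s ω| ≤ 2 * x := by
  have hbdd : BddAbove (Set.range fun t : Set.Icc (0:ℝ) 1 => |B t ω - B t₀ ω|) := by
    have hc' : ContinuousOn (fun t => |B t ω - B t₀ ω|) (Set.Icc 0 1) :=
      ((hc.mono Set.Icc_subset_Ici_self).sub continuousOn_const).abs
    have := (isCompact_Icc.image_of_continuousOn hc').bddAbove
    rw [Set.image_eq_range] at this
    exact this
  have h1 : ∀ s, s ∈ Set.Icc (0:ℝ) 1 → |B s ω - B t₀ ω| ≤ x := fun s hs =>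
    (le_ciSup hbdd (⟨s, hs⟩ : Set.Icc (0:ℝ) 1)).trans h
  have e1 := h1 s hs
  have e2 := h1 0 (by simp)
  rw [h0] at e2
  rw [abs_le] at *
  constructor <;> linarith [e1.1, e1.2, e2.1, e2.2]

lemma grid_upper (hB : IsBifBM μ H K B) (hH : 0 < H) (hK : 0 < K) {c : ℝ} (hc : 0 < c) {n : ℕ} (hn : 1 ≤ n)
    (hQ : ∀ a : Fin n → ℝ,
      c * (n:ℝ) ^ (-(2 * (H * K))) * ∑ i, a i ^ 2 ≤
        ∑ i, ∑ j, a i * a j * Rbif H K (((i:ℕ) + 1 : ℝ) / n) (((j:ℕ) + 1 : ℝ) / n))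
    {t₀ x : ℝ} (ht₀ : t₀ ∈ Set.Icc (0:ℝ) 1) (hx : 0 < x) :
    μ {ω | (⨆ t : Set.Icc (0:ℝ) 1, |B t ω - B t₀ ω|) ≤ x} ≤
      ENNReal.ofReal (4 / Real.sqrt (2 * Real.pi * c) * (x * (n:ℝ) ^ (H * K))) ^ n := by
  have hn0 : (0:ℝ) < n := by exact_mod_cast hn
  set w : Fin n → Unit → ℝ := fun _ _ => 1
  set t : Fin n → Unit → ℝ := fun i _ => ((i:ℕ) + 1 : ℝ) / n with htd
  have ht : ∀ i e, 0 ≤ t i e := fun i e => by simp only [htd]; positivity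
  have hm := vec_aem hB w t ht
  have hp : IsProbabilityMeasure (μ.map (fun ω (i : Fin n) => ∑ e, w i e * B (t i e) ω)) :=
    Measure.isProbabilityMeasure_map hm
  have hub := upper_box (Scov H K w t) (Scov_symm H K w t) (vec_law hB hH hK w t ht)
    (c * (n:ℝ) ^ (-(2 * (H * K)))) (by positivity) (fun a => by
      refine (hQ a).trans_eq ?_
      simp [Scov, w, t]) (2 * x) (by positivity)
  have hset : MeasurableSet {y : Fin n → ℝ | ∀ i, |y i| ≤ 2 * x} := by
    simp only [Set.ofPred_forall]
    exact MeasurableSet.iInter fun i => measurableSet_le (by fun_prop) measurable_const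
  rw [Measure.map_apply_of_aemeasurable hm hset, Fintype.card_fin] at hub
  have e : 2 * (2 * x) / Real.sqrt (2 * Real.pi * (c * (n:ℝ) ^ (-(2 * (H * K)))))
      = 4 / Real.sqrt (2 * Real.pi * c) * (x * (n:ℝ) ^ (H * K)) := by
    have : 2 * Real.pi * (c * (n:ℝ) ^ (-(2 * (H * K)))) = (2 * Real.pi * c) * ((n:ℝ) ^ (-(H * K))) ^ 2 := by
      rw [← Real.rpow_natCast, ← Real.rpow_mul hn0.le]
      push_cast
      rw [show -(H * K) * 2 = -(2 * (H * K)) by ring]; ring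
    rw [this, Real.sqrt_mul (by positivity), Real.sqrt_sq (by positivity), Real.rpow_neg hn0.le]
    have : (n:ℝ) ^ (H * K) ≠ 0 := by positivity
    have : Real.sqrt (2 * Real.pi * c) ≠ 0 := by positivity
    field_simp
    ring
  rw [e] at hub
  refine le_trans (measure_mono_ae ?_) hub
  filter_upwards [hB.1, B_zero hB hH hK] with ω hω h0 h
  have h' : (⨆ t : Set.Icc (0:ℝ) 1, |B t ω - B t₀ ω|) ≤ x := h
  show ∀ i : Fin n, |∑ e, w i e * B (t i e) ω| ≤ 2 * x
  intro i
  simp only [w, t, Finset.univ_unique, Finset.sum_singleton, one_mul]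
  apply event_sub hω h0 ht₀ h'
  refine ⟨by positivity, ?_⟩
  rw [div_le_one hn0]
  have := i.2
  exact_mod_cast this

lemma gauss_lt_one : gaussianReal 0 1 {y | |y| ≤ 2} < 1 := by
  have hm : MeasurableSet {y : ℝ | |y| ≤ 2} := measurableSet_le (by fun_prop) measurable_const
  rw [lt_iff_le_and_ne]
  refine ⟨prob_le_one, fun h => ?_⟩
  have h2 := (prob_compl_eq_zero_iff hm).2 h
  have h3 := gaussianReal_absolutelyContinuous' (μ := 0) (v := 1) one_ne_zero h2
  have h4 : (volume : Measure ℝ) (Set.Ioi 2) ≤ 0 := by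
    rw [← h3]
    apply measure_mono
    intro y hy
    have hy : 2 < y := hy
    have : ¬ |y| ≤ 2 := by
      rw [not_le]; exact hy.trans_le (le_abs_self y)
    exact this
  simp at h4

lemma upper_bound (hB : IsBifBM μ H K B) (hH : H ∈ Set.Ioo (0:ℝ) 1) (hK : K ∈ Set.Ioc (0:ℝ) 1) :
    ∃ c₃ : ℝ, 0 < c₃ ∧ ∀ t₀ ∈ Set.Icc (0:ℝ) 1, ∀ x ∈ Set.Ioo (0:ℝ) 1,
      μ {ω | (⨆ t : Set.Icc (0:ℝ) 1, |B t ω - B t₀ ω|) ≤ x} ≤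
            ENNReal.ofReal (Real.exp (-c₃ / x ^ (1 / (H * K)))) := by
  obtain ⟨c, hc, hQ⟩ := Q_lower hH hK
  have hH0 := hH.1
  have hK0 := hK.1
  have hγ : 0 < H * K := mul_pos hH0 hK0
  set γ := H * K with hγd
  set C := 4 / Real.sqrt (2 * Real.pi * c) with hC
  have hC0 : 0 < C := by positivity
  set δ : ℝ := (1 / (Real.exp 1 * C)) ^ (1 / γ) with hδ
  have hδ0 : 0 < δ := by positivity
  have hδγ : C * δ ^ γ = Real.exp (-1) := by
    rw [hδ, ← Real.rpow_mul (by positivity), one_div_mul_cancel hγ.ne', Real.rpow_one, Real.exp_neg]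
    field_simp
  set p : ℝ := max (1/2) (gaussianReal 0 1 {y | |y| ≤ 2}).toReal with hp
  have hp0 : 0 < p := lt_max_of_lt_left (by norm_num)
  have hp1 : p < 1 := by
    apply max_lt (by norm_num)
    have := (ENNReal.toReal_lt_toReal (measure_ne_top _ _) ENNReal.one_ne_top).2 gauss_lt_one
    simpa using this
  have hlog : Real.log p < 0 := Real.log_neg hp0 hp1
  refine ⟨min (δ / 2) (-(δ * Real.log p)), lt_min (by positivity) (by nlinarith), ?_⟩
  set c₃ := min (δ / 2) (-(δ * Real.log p)) with hc₃
  have hc₃0 : 0 < c₃ := lt_min (by positivity) (by nlinarith)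
  intro t₀ ht₀ x hx
  have hx0 := hx.1
  set y := x ^ (1 / γ) with hy
  have hy0 : 0 < y := by positivity
  have hyγ : y ^ γ = x := by
    rw [hy, ← Real.rpow_mul hx0.le, one_div_mul_cancel hγ.ne', Real.rpow_one]
  rcases le_or_gt 1 (δ / y) with h1 | h1
  · set n := ⌊δ / y⌋₊ with hn
    have hn1 : 1 ≤ n := Nat.le_floor (by simpa using h1)
    have hn0 : (0:ℝ) < n := by exact_mod_cast hn1
    refine (grid_upper hB hH0 hK0 hc hn1 (hQ n hn1) ht₀ hx0).trans ?_
    rw [← ENNReal.ofReal_pow (by positivity)]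
    apply ENNReal.ofReal_le_ofReal
    have hb : C * (x * (n:ℝ) ^ γ) ≤ Real.exp (-1) := by
      have : (n:ℝ) ^ γ ≤ (δ / y) ^ γ := Real.rpow_le_rpow hn0.le (Nat.floor_le (by positivity)) hγ.le
      rw [Real.div_rpow hδ0.le hy0.le, hyγ] at this
      calc C * (x * (n:ℝ) ^ γ) ≤ C * (x * (δ ^ γ / x)) := by gcongr
        _ = C * δ ^ γ := by field_simp
        _ = _ := hδγ
    calc (C * (x * (n:ℝ) ^ γ)) ^ n ≤ (Real.exp (-1)) ^ n := by gcongr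
      _ = Real.exp (-(n:ℝ)) := by rw [← Real.exp_nat_mul]; ring_nf
      _ ≤ _ := by
        rw [Real.exp_le_exp, neg_div, neg_le_neg_iff]
        have h2 : δ / y < n + 1 := Nat.lt_floor_add_one _
        have h3 : (1:ℝ) ≤ n := by exact_mod_cast hn1
        calc c₃ / y ≤ (δ / 2) / y := by gcongr; exact min_le_left _ _
          _ = (δ / y) / 2 := by ring
          _ ≤ n := by linarith
  · have e1 : μ {ω | (⨆ t : Set.Icc (0:ℝ) 1, |B t ω - B t₀ ω|) ≤ x} ≤ gaussianReal 0 1 {y | |y| ≤ 2} := by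
      have hl := one_law hB (zero_le_one)
      have hR : Rbif H K 1 1 = 1 := by
        unfold Rbif
        rw [sub_self, abs_zero, Real.zero_rpow (by positivity), Real.one_rpow, sub_zero, Real.rpow_neg (by norm_num)]
        norm_num
        exact inv_mul_cancel₀ (by positivity)
      rw [hR, Real.toNNReal_one] at hl
      rw [← hl, Measure.map_apply_of_aemeasurable (one_aem hB zero_le_one)
        (measurableSet_le (by fun_prop) measurable_const)]
      apply measure_mono_ae
      filter_upwards [hB.1, B_zero hB hH0 hK0] with ω hω h0 h
      have := event_sub hω h0 ht₀ h (s := 1) (by simp)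
      show |B 1 ω| ≤ 2
      linarith [hx.2]
    refine e1.trans ?_
    rw [← ENNReal.ofReal_toReal (measure_ne_top (gaussianReal 0 1) {y | |y| ≤ 2})]
    apply ENNReal.ofReal_le_ofReal
    refine (le_max_right (1/2) _).trans ?_
    change p ≤ _
    rw [← Real.exp_log hp0, Real.exp_le_exp, neg_div, le_neg]
    rw [div_lt_one hy0] at h1
    calc c₃ / y ≤ c₃ / δ := by gcongr
      _ ≤ -(δ * Real.log p) / δ := by gcongr; exact min_le_right _ _
      _ = _ := by field_simp

end
end BifSB

namespace BifSB

lemma zero_sum_pow {K : ℝ} (hK0 : 0 < K) (hK1 : K ≤ 1) {κ : Type*} [Fintype κ] (u α : κ → ℝ) (hu : ∀ i, 0 ≤ u i)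
    (hα : ∑ i, α i = 0) : ∑ i, ∑ j, α i * α j * (u j + u i) ^ K ≤ 0 := by
  rcases hK1.eq_or_lt with rfl | hK1
  · simp only [Real.rpow_one, mul_add, Finset.sum_add_distrib]
    have e1 : ∑ i, ∑ j, α i * α j * u j = 0 := by
      simp only [mul_assoc, ← Finset.mul_sum, ← Finset.sum_mul, hα, zero_mul]
    have e2 : ∑ i, ∑ j, α i * α j * u i = 0 := by
      rw [Finset.sum_comm, ← e1]
      exact Finset.sum_congr rfl fun i _ => Finset.sum_congr rfl fun j _ => by ring
    rw [e1, e2]; simp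
  · have hD : ∀ r : ℝ, ∑ p : κ × κ, -(α p.1 * α p.2) * (1 - Real.exp (-((u p.2 + u p.1) * r))) =
        (∑ i, α i * Real.exp (-(u i * r))) ^ 2 := by
      intro r
      rw [Fintype.sum_prod_type, sq, Finset.sum_mul_sum]
      have e1 : ∑ i, ∑ j, α i * α j = 0 := by
        simp only [← Finset.mul_sum, hα, mul_zero, Finset.sum_const_zero]
      rw [← add_zero (∑ x, ∑ y, _), ← e1, ← Finset.sum_add_distrib]
      refine Finset.sum_congr rfl fun i _ => ?_
      rw [← Finset.sum_add_distrib]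
      refine Finset.sum_congr rfl fun j _ => ?_
      beta_reduce
      rw [show -((u j + u i) * r) = -(u i * r) + -(u j * r) by ring, Real.exp_add]
      ring
    have := laplace_lower hK0 hK1 (σ := κ × κ) (fun p => -(α p.1 * α p.2)) (fun p => u p.2 + u p.1)
      (fun p => add_nonneg (hu _) (hu _)) 1 0 one_pos (fun r _ => by rw [hD]; positivity)
      (fun r _ => by rw [hD]; positivity)
    rw [zero_mul] at this
    have h2 := nonneg_of_mul_nonneg_right this (cpow_pos hK0 hK1)
    simp only [Fintype.sum_prod_type, neg_mul, Finset.sum_neg_distrib] at h2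
    linarith

/-- iterated forward differences of the power function -/
noncomputable def Dp : ℕ → ℝ → ℝ → ℝ
  | 0, q, x => x ^ q
  | n + 1, q, x => Dp n q (x + 1) - Dp n q x

lemma Dp_deriv (n : ℕ) : ∀ (q x : ℝ), 0 < x → HasDerivAt (Dp n q) (q * Dp n (q - 1) x) x := by
  induction n with
  | zero =>
    intro q x hx
    exact Real.hasDerivAt_rpow_const (Or.inl hx.ne')
  | succ n ih =>
    intro q x hx
    have h1 := (ih q (x + 1) (by linarith)).comp_add_const x 1
    have h2 := h1.sub (ih q x hx)
    rw [← mul_sub] at h2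
    exact h2

lemma Dp_bound (n : ℕ) : ∀ q : ℝ, q ≤ n → ∃ C : ℝ, 0 ≤ C ∧ ∀ x, 0 < x → |Dp n q x| ≤ C * x ^ (q - n) := by
  induction n with
  | zero =>
    intro q _
    refine ⟨1, zero_le_one, fun x hx => ?_⟩
    simp only [Dp, Nat.cast_zero, sub_zero, one_mul]
    rw [abs_of_nonneg (by positivity)]
  | succ n ih =>
    intro q hq
    push_cast at hq
    obtain ⟨C, hC, hb⟩ := ih (q - 1) (by linarith)
    refine ⟨|q| * C, by positivity, fun x hx => ?_⟩
    obtain ⟨c, hc, he⟩ := exists_hasDerivAt_eq_slope (Dp n q) (fun x => q * Dp n (q - 1) x)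
      (show x < x + 1 by linarith)
      (fun y hy => (Dp_deriv n q y (hx.trans_le hy.1)).continuousAt.continuousWithinAt)
      (fun y hy => Dp_deriv n q y (hx.trans hy.1))
    rw [add_sub_cancel_left, div_one] at he
    simp only [Dp]
    rw [← he, abs_mul, mul_assoc]
    apply mul_le_mul_of_nonneg_left _ (abs_nonneg q)
    refine (hb c (hx.trans hc.1)).trans ?_
    apply mul_le_mul_of_nonneg_left _ hC
    push_cast
    rw [show q - (n + 1 : ℝ) = q - 1 - n by ring]
    exact Real.rpow_le_rpow_of_nonpos hx hc.1.le (by linarith)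

/-- the kernel of second differences -/
noncomputable def Gam (q y : ℝ) : ℝ :=
  (3/2) * |y| ^ q - |y + 1| ^ q - |y - 1| ^ q + (1/4) * |y + 2| ^ q + (1/4) * |y - 2| ^ q

lemma Gam_neg (q y : ℝ) : Gam q (-y) = Gam q y := by
  unfold Gam
  rw [abs_neg, show -y + 1 = -(y - 1) by ring, show -y - 1 = -(y + 1) by ring,
    show -y + 2 = -(y - 2) by ring, show -y - 2 = -(y + 2) by ring]
  simp only [abs_neg]
  ring

lemma Gam_bound {q : ℝ} (hq0 : 0 < q) (hq2 : q ≤ 2) :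
    ∃ C : ℝ, 0 < C ∧ ∀ k : ℕ, |Gam q (2 * k)| ≤ C / ((k:ℝ) + 1) ^ 2 := by
  obtain ⟨C, hC, hb⟩ := Dp_bound 4 q (by push_cast; linarith)
  refine ⟨256 + 4 * C, by positivity, fun k => ?_⟩
  rcases lt_or_ge k 2 with hk | hk
  · have hb1 : ∀ y : ℝ, |y| ≤ 4 → 0 ≤ |y| ^ q ∧ |y| ^ q ≤ 16 := by
      intro y hy
      refine ⟨by positivity, ?_⟩
      calc |y| ^ q ≤ 4 ^ q := Real.rpow_le_rpow (abs_nonneg _) hy hq0.le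
        _ ≤ 4 ^ (2:ℝ) := Real.rpow_le_rpow_of_exponent_le (by norm_num) hq2
        _ = 16 := by norm_num
    have hk1 : (k:ℝ) ≤ 1 := by exact_mod_cast Nat.lt_succ_iff.1 hk
    have hk0 : (0:ℝ) ≤ k := Nat.cast_nonneg k
    have h1 := hb1 (2 * k) (by rw [abs_le]; constructor <;> linarith)
    have h2 := hb1 (2 * k + 1) (by rw [abs_le]; constructor <;> linarith)
    have h3 := hb1 (2 * k - 1) (by rw [abs_le]; constructor <;> linarith)
    have h4 := hb1 (2 * k + 2) (by rw [abs_le]; constructor <;> linarith)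
    have h5 := hb1 (2 * k - 2) (by rw [abs_le]; constructor <;> linarith)
    have : |Gam q (2 * k)| ≤ 64 := by
      unfold Gam
      rw [abs_le]; constructor <;> linarith [h1.1, h1.2, h2.1, h2.2, h3.1, h3.2, h4.1, h4.2, h5.1, h5.2]
    refine this.trans ?_
    rw [le_div_iff₀ (by positivity)]
    nlinarith
  · have hk2 : (2:ℝ) ≤ k := by exact_mod_cast hk
    have e : Gam q (2 * k) = (1/4) * Dp 4 q (2 * k - 2) := by
      unfold Gam
      rw [abs_of_nonneg (by linarith), abs_of_nonneg (by linarith), abs_of_nonneg (by linarith),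
        abs_of_nonneg (by linarith), abs_of_nonneg (by linarith)]
      simp only [Dp]
      rw [show (2 * k - 2 + 1 + 1 + 1 + 1 : ℝ) = 2 * k + 2 by ring,
        show (2 * k - 2 + 1 + 1 + 1 : ℝ) = 2 * k + 1 by ring, show (2 * k - 2 + 1 + 1 : ℝ) = 2 * k by ring,
        show (2 * k - 2 + 1 : ℝ) = 2 * k - 1 by ring]
      ring
    rw [e, abs_mul, abs_of_nonneg (by norm_num : (0:ℝ) ≤ 1/4)]
    have h1 := hb (2 * k - 2) (by linarith)
    have h2 : ((2:ℝ) * k - 2) ^ (q - (4:ℕ)) ≤ (((k:ℝ) + 1) / 2) ^ (-(2:ℝ)) := by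
      calc ((2:ℝ) * k - 2) ^ (q - (4:ℕ)) ≤ ((2:ℝ) * k - 2) ^ (-(2:ℝ)) :=
            Real.rpow_le_rpow_of_exponent_le (by linarith) (by push_cast; linarith)
        _ ≤ _ := Real.rpow_le_rpow_of_nonpos (by positivity) (by linarith) (by norm_num)
    have h3 : (((k:ℝ) + 1) / 2) ^ (-(2:ℝ)) = 4 / ((k:ℝ) + 1) ^ 2 := by
      rw [Real.rpow_neg (by positivity), show (2:ℝ) = ((2:ℕ):ℝ) by norm_num, Real.rpow_natCast]
      push_cast
      rw [div_pow, inv_div]; norm_num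
    rw [h3] at h2
    calc 1 / 4 * |Dp 4 q (2 * k - 2)| ≤ 1 / 4 * (C * (4 / ((k:ℝ) + 1) ^ 2)) := by
          gcongr; exact h1.trans (by gcongr)
      _ = C / ((k:ℝ) + 1) ^ 2 := by ring
      _ ≤ _ := by gcongr; linarith

/-- weights of second differences -/
noncomputable def dw : Fin 3 → ℝ := ![-1/2, 1, -1/2]

lemma level_var {H K : ℝ} (hH : H ∈ Set.Ioo (0:ℝ) 1) (hK : K ∈ Set.Ioc (0:ℝ) 1) :
    ∃ C : ℝ, 0 < C ∧ ∀ (N : ℕ) (h : ℝ), 0 < h → ∀ a : Fin N → ℝ,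
      ∑ i, ∑ j, a i * a j * Scov H K (fun (_ : Fin N) => dw)
        (fun j e => (2 * (j:ℕ) + (e:ℕ) : ℝ) * h) i j ≤ C * h ^ (2 * (H * K)) * ∑ i, a i ^ 2 := by
  obtain ⟨hH0, hH1⟩ := hH
  obtain ⟨hK0, hK1⟩ := hK
  have hq0 : 0 < 2 * (H * K) := by positivity
  have hq2 : 2 * (H * K) ≤ 2 := by nlinarith
  set q := 2 * (H * K) with hq
  obtain ⟨C, hC, hb⟩ := Gam_bound hq0 hq2
  set g : ℕ → ℝ := fun k => C / ((k:ℝ) + 1) ^ 2 with hg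
  have hg0 : ∀ k, 0 ≤ g k := fun k => by simp only [hg]; positivity
  have hgs : Summable g := by
    have : Summable fun k : ℕ => C * (1 / ((k:ℝ)) ^ 2) :=
      (Real.summable_one_div_nat_pow.2 (by norm_num)).mul_left _
    rw [← summable_nat_add_iff 1] at this
    refine this.congr fun k => ?_
    simp only [hg]; push_cast; ring
  have hT : 0 < ∑' k, g k := hgs.tsum_pos hg0 0 (by simp only [hg]; positivity)
  refine ⟨2 * ∑' k, g k, by positivity, fun N h hh a => ?_⟩
  rw [Scov_form]
  have hz := zero_sum_pow hK0 hK1 (κ := Fin N × Fin 3) (fun p => ((2 * (p.1:ℕ) + (p.2:ℕ) : ℝ) * h) ^ (2 * H))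
    (fun p => a p.1 * dw p.2) (fun p => by positivity) (by
      rw [Fintype.sum_prod_type]
      simp only [← Finset.mul_sum, Fin.sum_univ_three, dw]
      simp; norm_num)
  have h2K : (2:ℝ) ^ (-K) ≤ 1 := Real.rpow_le_one_of_one_le_of_nonpos (by norm_num) (by linarith)
  have h2K0 : (0:ℝ) < (2:ℝ) ^ (-K) := by positivity
  have hE : ∑ p : Fin N × Fin 3, ∑ p' : Fin N × Fin 3, (a p.1 * dw p.2) * (a p'.1 * dw p'.2) *
      |(2 * (p'.1:ℕ) + (p'.2:ℕ) : ℝ) * h - (2 * (p.1:ℕ) + (p.2:ℕ) : ℝ) * h| ^ (2 * H * K)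
      = ∑ i, ∑ j, a i * a j * (h ^ q * Gam q (2 * (i:ℕ) - 2 * (j:ℕ))) := by
    simp only [Fintype.sum_prod_type]
    refine Finset.sum_congr rfl fun i _ => ?_
    rw [Finset.sum_comm]
    refine Finset.sum_congr rfl fun j _ => ?_
    have e : ∀ x y : ℝ, |y * h - x * h| ^ (2 * H * K) = h ^ q * |x - y| ^ q := by
      intro x y
      rw [← sub_mul, abs_mul, abs_of_pos hh, Real.mul_rpow (abs_nonneg _) hh.le, abs_sub_comm, mul_assoc 2 H K]
      ring
    simp only [e, Fin.sum_univ_three, dw, Gam]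
    simp only [Matrix.cons_val_zero, Matrix.cons_val_one, Matrix.cons_val, Fin.val_zero, Fin.val_one, Fin.val_two]
    push_cast
    set I : ℝ := ((i:ℕ):ℝ)
    set J : ℝ := ((j:ℕ):ℝ)
    rw [show 2 * I + 0 - (2 * J + 0) = 2 * I - 2 * J by ring, show 2 * I + 0 - (2 * J + 1) = 2 * I - 2 * J - 1 by ring,
      show 2 * I + 0 - (2 * J + 2) = 2 * I - 2 * J - 2 by ring,
      show 2 * I + 1 - (2 * J + 0) = 2 * I - 2 * J + 1 by ring, show 2 * I + 1 - (2 * J + 1) = 2 * I - 2 * J by ring,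
      show 2 * I + 1 - (2 * J + 2) = 2 * I - 2 * J - 1 by ring,
      show 2 * I + 2 - (2 * J + 0) = 2 * I - 2 * J + 2 by ring, show 2 * I + 2 - (2 * J + 1) = 2 * I - 2 * J + 1 by ring,
      show 2 * I + 2 - (2 * J + 2) = 2 * I - 2 * J by ring]
    ring
  have hGb : ∀ i j : ℕ, |Gam q (2 * (i:ℝ) - 2 * (j:ℝ))| ≤ g ((i - j) + (j - i)) := by
    have : ∀ i j : ℕ, j ≤ i → |Gam q (2 * (i:ℝ) - 2 * (j:ℝ))| ≤ g ((i - j) + (j - i)) := by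
      intro i j hij
      have := hb (i - j)
      rw [Nat.cast_sub hij, mul_sub] at this
      rw [Nat.sub_eq_zero_of_le hij, add_zero]
      simp only [hg]
      rwa [Nat.cast_sub hij]
    intro i j
    rcases le_total j i with h | h
    · exact this i j h
    · rw [← Gam_neg, neg_sub, add_comm]; exact this j i h
  have hS := schur_test (fun i j : Fin N => g (((i:ℕ) - (j:ℕ)) + ((j:ℕ) - (i:ℕ)))) (fun i j => by rw [add_comm])
    (fun i j => hg0 _) (2 * ∑' k, g k) (fun i => by
      have := dist_sum_le g hgs hg0 N i
      rwa [← Fin.sum_univ_eq_sum_range (fun j => g (((i:ℕ) - j) + (j - (i:ℕ))))] at this) a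
  have hfin : -(∑ i, ∑ j, a i * a j * (h ^ q * Gam q (2 * ((i:ℕ):ℝ) - 2 * ((j:ℕ):ℝ)))) ≤
      h ^ q * ∑ i, ∑ j, |a i| * |a j| * g (((i:ℕ) - (j:ℕ)) + ((j:ℕ) - (i:ℕ))) := by
    rw [← Finset.sum_neg_distrib, Finset.mul_sum]
    refine Finset.sum_le_sum fun i _ => ?_
    rw [← Finset.sum_neg_distrib, Finset.mul_sum]
    refine Finset.sum_le_sum fun j _ => ?_
    refine (neg_le_abs _).trans ?_
    rw [abs_mul, abs_mul, abs_mul, abs_of_pos (show 0 < h ^ q by positivity)]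
    have := hGb i j
    calc |a i| * |a j| * (h ^ q * |Gam q (2 * ((i:ℕ):ℝ) - 2 * ((j:ℕ):ℝ))|)
        ≤ |a i| * |a j| * (h ^ q * g (((i:ℕ) - (j:ℕ)) + ((j:ℕ) - (i:ℕ)))) := by gcongr
      _ = _ := by ring
  have hsplit : ∑ p : Fin N × Fin 3, ∑ p' : Fin N × Fin 3, (a p.1 * dw p.2) * (a p'.1 * dw p'.2) *
      Rbif H K ((2 * (p.1:ℕ) + (p.2:ℕ) : ℝ) * h) ((2 * (p'.1:ℕ) + (p'.2:ℕ) : ℝ) * h) =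
      (2:ℝ) ^ (-K) * ((∑ p : Fin N × Fin 3, ∑ p' : Fin N × Fin 3, (a p.1 * dw p.2) * (a p'.1 * dw p'.2) *
        (((2 * (p'.1:ℕ) + (p'.2:ℕ) : ℝ) * h) ^ (2 * H) + ((2 * (p.1:ℕ) + (p.2:ℕ) : ℝ) * h) ^ (2 * H)) ^ K) -
      ∑ p : Fin N × Fin 3, ∑ p' : Fin N × Fin 3, (a p.1 * dw p.2) * (a p'.1 * dw p'.2) *
      |(2 * (p'.1:ℕ) + (p'.2:ℕ) : ℝ) * h - (2 * (p.1:ℕ) + (p.2:ℕ) : ℝ) * h| ^ (2 * H * K)) := by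
    rw [← Finset.sum_sub_distrib, Finset.mul_sum]
    refine Finset.sum_congr rfl fun p _ => ?_
    rw [← Finset.sum_sub_distrib, Finset.mul_sum]
    refine Finset.sum_congr rfl fun p' _ => ?_
    unfold Rbif; ring
  rw [hsplit, hE]
  have hhq : 0 < h ^ q := by positivity
  have hfin2 := hfin.trans (mul_le_mul_of_nonneg_left hS hhq.le)
  set X := ∑ i, ∑ j, a i * a j * (h ^ q * Gam q (2 * ((i:ℕ):ℝ) - 2 * ((j:ℕ):ℝ)))
  have hnn : 0 ≤ h ^ q * ((2 * ∑' k, g k) * ∑ i, a i ^ 2) := by positivity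
  calc _ ≤ (2:ℝ) ^ (-K) * (h ^ q * ((2 * ∑' k, g k) * ∑ i, a i ^ 2)) := by
        apply mul_le_mul_of_nonneg_left _ h2K0.le
        linarith
    _ ≤ 1 * (h ^ q * ((2 * ∑' k, g k) * ∑ i, a i ^ 2)) := by gcongr
    _ = _ := by ring

end BifSB

namespace BifSB

lemma gauss_meas_set (ρ : ℝ) : MeasurableSet {y : ℝ | |y| ≤ ρ} :=
  measurableSet_le (by fun_prop) measurable_const

lemma gauss_lin : ∃ κ : ℝ, 0 < κ ∧ ∀ ρ : ℝ, 0 ≤ ρ → ρ ≤ 1 →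
    κ * ρ ≤ (gaussianReal 0 1).real {y | |y| ≤ ρ} := by
  set m : ℝ := (Real.sqrt (2 * Real.pi))⁻¹ * Real.exp (-1/2) with hm
  have hm0 : 0 < m := by positivity
  refine ⟨2 * m, by positivity, fun ρ h0 h1 => ?_⟩
  have hset : {y : ℝ | |y| ≤ ρ} = Set.Icc (-ρ) ρ := by ext y; simp [abs_le]
  have : ENNReal.ofReal (2 * m * ρ) ≤ gaussianReal 0 1 {y | |y| ≤ ρ} := by
    rw [gaussianReal_apply 0 one_ne_zero]
    calc ENNReal.ofReal (2 * m * ρ) = ∫⁻ _ in {y : ℝ | |y| ≤ ρ}, ENNReal.ofReal m := by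
          rw [setLIntegral_const, hset, Real.volume_Icc, ← ENNReal.ofReal_mul hm0.le]
          congr 1; ring
      _ ≤ _ := by
          apply setLIntegral_mono' (gauss_meas_set ρ)
          intro y hy
          have hy : |y| ≤ ρ := hy
          unfold gaussianPDF
          apply ENNReal.ofReal_le_ofReal
          rw [gaussianPDFReal, hm]
          simp only [NNReal.coe_one, mul_one, sub_zero]
          gcongr
          rw [← sq_abs]
          nlinarith [abs_nonneg y]
  rw [Measure.real]
  exact (ENNReal.ofReal_le_iff_le_toReal (measure_ne_top _ _)).1 this

lemma gauss_tail {p : ℝ} (hp : 0 < p) : ∃ M : ℝ, 0 ≤ M ∧ ∀ ρ : ℝ, 0 < ρ →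
    1 - (gaussianReal 0 1).real {y | |y| ≤ ρ} ≤ M * ρ ^ (-p) := by
  have hi : Integrable (fun y : ℝ => |y| ^ p) (gaussianReal 0 1) := by
    have := (memLp_id_gaussianReal (μ := 0) (v := 1) p.toNNReal).integrable_norm_rpow'
    simpa [hp.le] using this
  refine ⟨∫ y, |y| ^ p ∂(gaussianReal 0 1), integral_nonneg fun y => by positivity, fun ρ hρ => ?_⟩
  have h1 := mul_meas_ge_le_integral_of_nonneg (ae_of_all _ fun y => by positivity) hi (ρ ^ p)
  have h2 : 1 - (gaussianReal 0 1).real {y | |y| ≤ ρ} ≤ (gaussianReal 0 1).real {y | ρ ^ p ≤ |y| ^ p} := by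
    rw [← probReal_compl_eq_one_sub (gauss_meas_set ρ)]
    refine measureReal_mono (fun y hy => ?_) (measure_ne_top _ _)
    have hy : ¬ |y| ≤ ρ := hy
    push Not at hy
    exact Real.rpow_le_rpow hρ.le hy.le hp.le
  rw [Real.rpow_neg hρ.le, ← div_eq_mul_inv, le_div_iff₀ (by positivity), mul_comm]
  exact (mul_le_mul_of_nonneg_left h2 (by positivity)).trans h1

lemma gauss_small_one {p : ℝ} (hp : 0 < p) : ∃ C : ℝ, 0 < C ∧ ∀ ρ : ℝ, 0 < ρ →
    Real.exp (-(C * ρ ^ (-p))) ≤ (gaussianReal 0 1).real {y | |y| ≤ ρ} := by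
  obtain ⟨κ, hκ, h1⟩ := gauss_lin
  obtain ⟨M, hM, h2⟩ := gauss_tail hp
  refine ⟨1 / p + |Real.log κ| + M / κ, by positivity, fun ρ hρ => ?_⟩
  have hρp : 0 < ρ ^ (-p) := by positivity
  rcases le_total ρ 1 with h | h
  · refine le_trans ?_ (h1 ρ hρ.le h)
    rw [← Real.exp_log (show 0 < κ * ρ by positivity), Real.exp_le_exp, Real.log_mul hκ.ne' hρ.ne']
    have e1 := Real.log_le_rpow_div (x := ρ⁻¹) (by positivity) hp
    rw [Real.log_inv, Real.inv_rpow hρ.le, ← Real.rpow_neg hρ.le] at e1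
    have e2 : 1 ≤ ρ ^ (-p) := Real.one_le_rpow_of_pos_of_le_one_of_nonpos hρ h (by linarith)
    have e3 : -|Real.log κ| ≤ Real.log κ := neg_abs_le _
    have e4 : |Real.log κ| ≤ |Real.log κ| * ρ ^ (-p) := le_mul_of_one_le_right (abs_nonneg _) e2
    have e5 : 0 ≤ M / κ * ρ ^ (-p) := by positivity
    have e6 : ρ ^ (-p) / p = 1 / p * ρ ^ (-p) := by ring
    linarith [add_mul (1 / p + |Real.log κ|) (M / κ) (ρ ^ (-p)), add_mul (1/p) (|Real.log κ|) (ρ ^ (-p))]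
  · set P := (gaussianReal 0 1).real {y | |y| ≤ ρ} with hP
    have hPκ : κ ≤ P := by
      have := h1 1 zero_le_one le_rfl
      rw [mul_one] at this
      refine this.trans (measureReal_mono fun y hy => ?_)
      exact le_trans (show |y| ≤ 1 from hy) h
    have hP0 : 0 < P := by linarith
    rw [← Real.exp_log hP0, Real.exp_le_exp]
    have e1 := Real.one_sub_inv_le_log_of_pos hP0
    refine le_trans ?_ e1
    have e2 := h2 ρ hρ
    have hP1 : P ≤ 1 := measureReal_le_one
    have e3 : P⁻¹ - 1 ≤ M / κ * ρ ^ (-p) := by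
      calc P⁻¹ - 1 = (1 - P) / P := by field_simp
        _ ≤ (1 - P) / κ := by gcongr
        _ ≤ (M * ρ ^ (-p)) / κ := by gcongr
        _ = _ := by ring
    have e4 : 0 ≤ 1 / p * ρ ^ (-p) := by positivity
    have e5 : 0 ≤ |Real.log κ| * ρ ^ (-p) := by positivity
    linarith [add_mul (1 / p + |Real.log κ|) (M / κ) (ρ ^ (-p)), add_mul (1/p) (|Real.log κ|) (ρ ^ (-p))]

lemma gauss_small {p : ℝ} (hp : 0 < p) : ∃ C : ℝ, 0 < C ∧ ∀ (s x : ℝ) (v : NNReal), 0 < s → 0 < x → (v:ℝ) = s ^ 2 →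
    ENNReal.ofReal (Real.exp (-(C * (x / s) ^ (-p)))) ≤ gaussianReal 0 v {y | |y| ≤ x} := by
  obtain ⟨C, hC, h⟩ := gauss_small_one hp
  refine ⟨C, hC, fun s x v hs hx hv => ?_⟩
  have hm := gaussianReal_map_const_mul (μ := 0) (v := 1) s
  have hv' : (.mk (s ^ 2) (sq_nonneg _) * 1 : NNReal) = v := by
    rw [mul_one]; exact NNReal.eq hv.symm
  rw [mul_zero, hv'] at hm
  rw [← hm, Measure.map_apply (by fun_prop) (gauss_meas_set x)]
  have : (fun y => s * y) ⁻¹' {y : ℝ | |y| ≤ x} = {y | |y| ≤ x / s} := by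
    ext y
    simp only [Set.mem_preimage, Set.mem_ofPred_eq]
    rw [abs_mul, abs_of_pos hs, le_div_iff₀ hs, mul_comm]
  rw [this]
  exact ENNReal.ofReal_le_of_le_toReal (h (x / s) (by positivity))
end BifSB

namespace BifSB

lemma dist_geom {r : ℝ} (h0 : 0 ≤ r) (h1 : r < 1) (M n : ℕ) :
    ∑ k ∈ Finset.range M, r ^ ((n - k) + (k - n)) ≤ 2 / (1 - r) := by
  have := dist_sum_le (fun k => r ^ k) (summable_geometric_of_lt_one h0 h1) (fun k => by positivity) M n
  rw [tsum_geometric_of_lt_one h0 h1] at this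
  simpa [div_eq_mul_inv] using this

lemma params {γ C : ℝ} (hγ : 0 < γ) (hC : 0 < C) : ∃ c₂ : ℝ, 0 < c₂ ∧ ∀ x ∈ Set.Ioo (0:ℝ) 1,
    ∃ X W s E : ℕ → ℝ, (∀ k, 0 < X k) ∧ (∀ k, 0 < W k) ∧ (∀ k, 0 < s k) ∧
      (∀ M, ∑ k ∈ Finset.range M, W k ≤ 1) ∧
      (∀ M, ∑ k ∈ Finset.range M, Real.sqrt 2 * X k ≤ x / 2) ∧
      (∀ k, (W k)⁻¹ * (C * ((1/2 : ℝ) ^ k) ^ (2 * γ)) = s k ^ 2) ∧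
      (∀ k (v : NNReal), (v:ℝ) = s k ^ 2 →
        ENNReal.ofReal (Real.exp (-(E k))) ≤ gaussianReal 0 v {y | |y| ≤ X k}) ∧
      (∀ M, 2 * ∑ k ∈ Finset.range M, (2:ℝ) ^ k * E k ≤ c₂ / x ^ (1 / γ)) := by
  set q : ℝ := (2:ℝ) ^ (-(γ / 4)) with hq
  have hq0 : 0 < q := by positivity
  have hq1 : q < 1 := Real.rpow_lt_one_of_one_lt_of_neg (by norm_num) (by linarith)
  have hqq1 : q ^ 2 < 1 := by nlinarith
  set c0 : ℝ := (1 - q ^ 2) / 2 with hc0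
  have hc00 : 0 < c0 := by rw [hc0]; linarith
  set c1 : ℝ := (1 - q) / (4 * Real.sqrt 2) with hc1
  have hc10 : 0 < c1 := div_pos (by linarith) (by positivity)
  set A : ℝ := Real.sqrt (C / c0) with hA
  have hA0 : 0 < A := Real.sqrt_pos.2 (by positivity)
  have hA2 : A ^ 2 = C / c0 := Real.sq_sqrt (by positivity)
  set θ : ℝ := (2:ℝ) ^ (-(1/2 : ℝ)) with hθ
  have hθ0 : 0 < θ := by positivity
  have hθ1 : θ < 1 := Real.rpow_lt_one_of_one_lt_of_neg (by norm_num) (by norm_num)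
  have hθh : (1/2 : ℝ) ≤ θ := by
    rw [hθ, show (1/2:ℝ) = (2:ℝ) ^ (-(1:ℝ)) by rw [Real.rpow_neg_one]; norm_num]
    exact Real.rpow_le_rpow_of_exponent_le (by norm_num) (by norm_num)
  obtain ⟨C1, hC1, hg1⟩ := gauss_small (p := 1 / (3 * γ)) (by positivity)
  obtain ⟨C2, hC2, hg2⟩ := gauss_small (p := 4 / γ) (by positivity)
  set L : ℝ := C1 * (c1 / A) ^ (-(1 / (3 * γ))) + C2 * (c1 / A) ^ (-(4 / γ)) with hL
  have hL0 : 0 < L := by positivity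
  refine ⟨2 * (L * (2 / (1 - θ)) * 2), by
    have : 0 < 1 - θ := by linarith
    positivity, fun x hx => ?_⟩
  have hx0 := hx.1
  set y : ℝ := 1 / x ^ (1 / γ) with hy
  have hxp : 0 < x ^ (1 / γ) := by positivity
  have hy1 : 1 ≤ y := by
    rw [hy, le_div_iff₀ hxp, one_mul]
    exact Real.rpow_le_one hx0.le hx.2.le (by positivity)
  obtain ⟨m, hm1, hm2⟩ := exists_nat_pow_near hy1 (show (1:ℝ) < 2 by norm_num)
  set n := m + 1 with hn
  have hn2 : (2:ℝ) ^ n ≤ 2 * y := by rw [hn, pow_succ]; linarith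
  have hq4 : ∀ k : ℕ, q ^ (4 * k) = ((1/2:ℝ) ^ k) ^ γ := by
    intro k
    rw [hq, ← Real.rpow_natCast, ← Real.rpow_mul (by norm_num), one_div, inv_pow, ← Real.rpow_natCast,
      ← Real.rpow_neg (by norm_num), ← Real.rpow_mul (by norm_num)]
    congr 1; push_cast; ring
  have hqn : q ^ (4 * n) ≤ x := by
    rw [hq4]
    have e : (1/2:ℝ) ^ n ≤ x ^ (1 / γ) := by
      rw [one_div, inv_pow]
      rw [hy, div_lt_iff₀ hxp] at hm2
      rw [inv_le_iff_one_le_mul₀ (by positivity), mul_comm]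
      exact hm2.le
    calc ((1/2:ℝ) ^ n) ^ γ ≤ (x ^ (1 / γ)) ^ γ := Real.rpow_le_rpow (by positivity) e hγ.le
      _ = x := by rw [← Real.rpow_mul hx0.le, one_div_mul_cancel hγ.ne', Real.rpow_one]
  set d : ℕ → ℕ := fun k => (n - k) + (k - n) with hd
  set X : ℕ → ℝ := fun k => c1 * x * q ^ d k with hX
  set W : ℕ → ℝ := fun k => c0 * (q ^ 2) ^ d k with hW
  set s : ℕ → ℝ := fun k => A * q ^ (4 * k) / q ^ d k with hs
  set E : ℕ → ℝ := fun k => if k < n then C1 * (X k / s k) ^ (-(1 / (3 * γ))) else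
    C2 * (X k / s k) ^ (-(4 / γ)) with hE
  have hX0 : ∀ k, 0 < X k := fun k => by simp only [hX]; positivity
  have hW0 : ∀ k, 0 < W k := fun k => by simp only [hW]; positivity
  have hs0 : ∀ k, 0 < s k := fun k => by simp only [hs]; positivity
  refine ⟨X, W, s, E, hX0, hW0, hs0, fun M => ?_, fun M => ?_, fun k => ?_, fun k v hv => ?_, fun M => ?_⟩
  · simp only [hW, ← Finset.mul_sum]
    have := dist_geom (r := q ^ 2) (by positivity) hqq1 M n
    calc c0 * ∑ k ∈ Finset.range M, (q ^ 2) ^ d k ≤ c0 * (2 / (1 - q ^ 2)) := by gcongr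
      _ = 1 := by
        rw [hc0]
        have : 1 - q ^ 2 ≠ 0 := by linarith
        field_simp
  · simp only [hX, ← Finset.mul_sum]
    have := dist_geom hq0.le hq1 M n
    calc Real.sqrt 2 * (c1 * x * ∑ k ∈ Finset.range M, q ^ d k) ≤ Real.sqrt 2 * (c1 * x * (2 / (1 - q))) := by gcongr
      _ = x / 2 := by
        rw [hc1]
        have : 1 - q ≠ 0 := by linarith
        have : Real.sqrt 2 ≠ 0 := by positivity
        field_simp
        ring
  · simp only [hW, hs]
    rw [mul_comm 2 γ, Real.rpow_mul (by positivity), ← hq4, div_pow, mul_pow, hA2,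
      show (2:ℝ) = ((2:ℕ):ℝ) by norm_num, Real.rpow_natCast, ← pow_mul, ← pow_mul, ← pow_mul, mul_comm (d k) 2]
    field_simp
  · simp only [hE]
    split_ifs
    · exact hg1 (s k) (X k) v (hs0 k) (hX0 k) hv
    · exact hg2 (s k) (X k) v (hs0 k) (hX0 k) hv
  · have hρ : ∀ k, X k / s k = (c1 / A) * (x * q ^ (2 * d k) / q ^ (4 * k)) := by
      intro k
      simp only [hX, hs]
      field_simp
      ring
    have key : ∀ k, (2:ℝ) ^ k * E k ≤ L * 2 ^ n * θ ^ d k := by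
      intro k
      simp only [hE]
      split_ifs with hk
      · -- k < n
        have hdk : n = k + d k := by simp only [hd]; omega
        have h1 : (c1 / A) * q ^ (6 * d k) ≤ X k / s k := by
          rw [hρ]
          gcongr
          rw [le_div_iff₀ (by positivity), ← pow_add]
          calc q ^ (6 * d k + 4 * k) = q ^ (4 * n) * q ^ (2 * d k) := by
                rw [← pow_add]; congr 1; omega
            _ ≤ _ := by gcongr
        have h2 : (X k / s k) ^ (-(1 / (3 * γ))) ≤ ((c1 / A) * q ^ (6 * d k)) ^ (-(1 / (3 * γ))) :=
          Real.rpow_le_rpow_of_nonpos (by positivity) h1 (by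
            have : 0 < 1 / (3 * γ) := by positivity
            linarith)
        have h3 : (q ^ (6 * d k)) ^ (-(1 / (3 * γ))) = 2 ^ d k * θ ^ d k := by
          rw [hq, hθ, ← mul_pow, ← Real.rpow_natCast, ← Real.rpow_mul (by positivity), ← Real.rpow_mul (by positivity),
            ← Real.rpow_one_add' (by norm_num) (by norm_num), ← Real.rpow_natCast, ← Real.rpow_mul (by positivity)]
          congr 1; push_cast; field_simp; norm_num; try ring
        rw [Real.mul_rpow (by positivity) (by positivity), h3] at h2
        calc (2:ℝ) ^ k * (C1 * (X k / s k) ^ (-(1 / (3 * γ))))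
            ≤ (2:ℝ) ^ k * (C1 * ((c1 / A) ^ (-(1 / (3 * γ))) * (2 ^ d k * θ ^ d k))) := by gcongr
          _ = (C1 * (c1 / A) ^ (-(1 / (3 * γ)))) * 2 ^ n * θ ^ d k := by
            conv_rhs => rw [hdk, pow_add]
            ring
          _ ≤ _ := by
            have : 0 < C2 * (c1 / A) ^ (-(4 / γ)) := by positivity
            gcongr
            rw [hL]; linarith
      · have hdk : k = n + d k := by simp only [hd]; omega
        have h1 : (c1 / A) * (q ^ (2 * d k))⁻¹ ≤ X k / s k := by
          rw [hρ]
          gcongr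
          rw [inv_le_iff_one_le_mul₀ (by positivity), div_mul_eq_mul_div, le_div_iff₀ (by positivity), one_mul]
          calc q ^ (4 * k) = q ^ (4 * n) * q ^ (2 * d k) * q ^ (2 * d k) := by
                rw [← pow_add, ← pow_add]; congr 1; omega
            _ ≤ _ := by gcongr
        have h2 : (X k / s k) ^ (-(4 / γ)) ≤ ((c1 / A) * (q ^ (2 * d k))⁻¹) ^ (-(4 / γ)) :=
          Real.rpow_le_rpow_of_nonpos (by positivity) h1 (by
            have : 0 < 4 / γ := by positivity
            linarith)
        have h3 : ((q ^ (2 * d k))⁻¹) ^ (-(4 / γ)) = (1/2) ^ d k * (1/2) ^ d k := by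
          rw [Real.inv_rpow (by positivity), Real.rpow_neg (by positivity), inv_inv, hq, ← mul_pow,
            ← Real.rpow_natCast, ← Real.rpow_mul (by positivity), ← Real.rpow_mul (by positivity),
            show (1/2 * (1/2) : ℝ) = 2 ^ (-2:ℝ) by rw [Real.rpow_neg (by norm_num)]; norm_num,
            ← Real.rpow_natCast, ← Real.rpow_mul (by positivity)]
          congr 1; push_cast; field_simp
        rw [Real.mul_rpow (by positivity) (by positivity), h3] at h2
        calc (2:ℝ) ^ k * (C2 * (X k / s k) ^ (-(4 / γ)))
            ≤ (2:ℝ) ^ k * (C2 * ((c1 / A) ^ (-(4 / γ)) * ((1/2) ^ d k * (1/2) ^ d k))) := by gcongr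
          _ = (C2 * (c1 / A) ^ (-(4 / γ))) * 2 ^ n * (1/2) ^ d k := by
            have : (2:ℝ) ^ k = 2 ^ n * 2 ^ d k := by rw [← pow_add, ← hdk]
            rw [this]
            have : (2:ℝ) ^ d k * (1/2) ^ d k = 1 := by rw [← mul_pow]; norm_num
            linear_combination (C2 * (c1 / A) ^ (-(4 / γ))) * 2 ^ n * (1/2) ^ d k * this
          _ ≤ _ := by
            have : 0 < C1 * (c1 / A) ^ (-(1 / (3 * γ))) := by positivity
            gcongr
            rw [hL]; linarith
    have hsum := dist_geom hθ0.le hθ1 M n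
    have h1θ : 0 < 1 - θ := by linarith
    calc 2 * ∑ k ∈ Finset.range M, (2:ℝ) ^ k * E k ≤ 2 * ∑ k ∈ Finset.range M, L * 2 ^ n * θ ^ d k := by
          exact mul_le_mul_of_nonneg_left (Finset.sum_le_sum fun k _ => key k) (by norm_num)
      _ = 2 * (L * 2 ^ n * ∑ k ∈ Finset.range M, θ ^ d k) := by rw [← Finset.mul_sum]
      _ ≤ 2 * (L * (2 * y) * (2 / (1 - θ))) := by gcongr
      _ = _ := by rw [hy]; ring

end BifSB

namespace BifSB

section
variable {Ω : Type*} [MeasurableSpace Ω] {μ : Measure Ω} {H K : ℝ}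
  {B : ℝ → Ω → ℝ}

lemma form_int (hB : IsBifBM μ H K B) (hH : 0 < H) (hK : 0 < K) {ι ε : Type*} [Fintype ι] [Fintype ε]
    (w t : ι → ε → ℝ) (ht : ∀ i e, 0 ≤ t i e) (a : ι → ℝ) :
    ∑ i, ∑ j, a i * a j * Scov H K w t i j = ∫ ω, (∑ i, a i * ∑ e, w i e * B (t i e) ω) ^ 2 ∂μ := by
  have hs := comb_second hB (κ := ι × ε) (fun p => t p.1 p.2) (fun p => ht _ _) (fun p => a p.1 * w p.1 p.2)
  have hq := Q_nonneg hB hH hK (κ := ι × ε) (fun p => t p.1 p.2) (fun p => ht _ _) (fun p => a p.1 * w p.1 p.2)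
  rw [Real.coe_toNNReal _ hq] at hs
  rw [Scov_form, ← hs]
  have e : ∀ ω, ∑ i, a i * ∑ e, w i e * B (t i e) ω = ∑ p : ι × ε, a p.1 * w p.1 p.2 * B (t p.1 p.2) ω := by
    intro ω
    simp only [Fintype.sum_prod_type, Finset.mul_sum, mul_assoc]
  simp_rw [e]

lemma form_memLp (hB : IsBifBM μ H K B) {ι ε : Type*} [Fintype ι] [Fintype ε]
    (w t : ι → ε → ℝ) (ht : ∀ i e, 0 ≤ t i e) (a : ι → ℝ) :
    MemLp (fun ω => ∑ i, a i * ∑ e, w i e * B (t i e) ω) 2 μ :=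
  memLp_finsetSum _ fun i _ => (memLp_finsetSum _ fun e _ =>
    (one_memLp hB (ht i e)).const_mul (w i e)).const_mul (a i)

lemma cross (hB : IsBifBM μ H K B) (hH : 0 < H) (hK : 0 < K) {κ ε : Type*} {β : κ → Type*} [Fintype κ]
    [∀ k, Fintype (β k)] [Fintype ε]
    (w t : (Σ k, β k) → ε → ℝ) (ht : ∀ i e, 0 ≤ t i e) (W : κ → ℝ) (hW : ∀ k, 0 < W k)
    (hW1 : ∑ k, W k ≤ 1) (a : (Σ k, β k) → ℝ) :
    ∑ i, ∑ j, a i * a j * Scov H K w t i j ≤ ∑ k, (W k)⁻¹ * ∑ i, ∑ j, a ⟨k, i⟩ * a ⟨k, j⟩ *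
      Scov H K (fun i => w ⟨k, i⟩) (fun i => t ⟨k, i⟩) i j := by
  rw [form_int hB hH hK w t ht a]
  have h1 : ∀ k, ∑ i, ∑ j, a ⟨k, i⟩ * a ⟨k, j⟩ *
      Scov H K (fun i => w ⟨k, i⟩) (fun i => t ⟨k, i⟩) i j = _ := fun k =>
    form_int hB hH hK (fun i => w ⟨k, i⟩) (fun i => t ⟨k, i⟩) (fun i => ht _) (fun i => a ⟨k, i⟩)
  simp_rw [h1]
  have hm : ∀ k, Integrable _ μ := fun k =>
    (form_memLp hB (fun i => w ⟨k, i⟩) (fun i => t ⟨k, i⟩) (fun i => ht _) (fun i => a ⟨k, i⟩)).integrable_sq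
  simp_rw [← integral_const_mul]
  rw [← integral_finsetSum _ fun k _ => (hm k).const_mul _]
  refine integral_mono (form_memLp hB w t ht a).integrable_sq
    (integrable_finsetSum _ fun k _ => (hm k).const_mul _) fun ω => ?_
  simp only [Fintype.sum_sigma]
  set Z : κ → ℝ := fun k => ∑ i, a ⟨k, i⟩ * ∑ e, w ⟨k, i⟩ e * B (t ⟨k, i⟩ e) ω with hZ
  have := Finset.sum_sq_le_sum_mul_sum_of_sq_eq_mul Finset.univ (r := Z) (f := W)
    (g := fun k => (W k)⁻¹ * Z k ^ 2) (fun k _ => (hW k).le)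
    (fun k _ => mul_nonneg (inv_nonneg.2 (hW k).le) (sq_nonneg _)) (fun k _ => by
      have := (hW k).ne'
      field_simp)
  refine this.trans ?_
  have h0 : 0 ≤ ∑ k, (W k)⁻¹ * Z k ^ 2 :=
    Finset.sum_nonneg fun k _ => mul_nonneg (inv_nonneg.2 (hW k).le) (sq_nonneg _)
  calc _ ≤ 1 * ∑ k, (W k)⁻¹ * Z k ^ 2 := by gcongr
    _ = _ := one_mul _

/-- weights at a given dyadic level -/
noncomputable def lw (k : ℕ) : Fin 3 → ℝ := if k = 0 then ![0, 1, 0] else dw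

/-- dyadic nodes at a given level -/
noncomputable def lt' (k j : ℕ) (e : Fin 3) : ℝ := (2 * (j:ℕ) + (e:ℕ) : ℝ) * (1/2 : ℝ) ^ k

lemma Rbif_one (hH : 0 < H) (hK : 0 < K) : Rbif H K 1 1 = 1 := by
  unfold Rbif
  rw [sub_self, abs_zero, Real.zero_rpow (by positivity), Real.one_rpow, sub_zero, Real.rpow_neg (by norm_num)]
  norm_num
  exact inv_mul_cancel₀ (by positivity)

lemma level_var' (hH : H ∈ Set.Ioo (0:ℝ) 1) (hK : K ∈ Set.Ioc (0:ℝ) 1) :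
    ∃ C : ℝ, 0 < C ∧ ∀ (k : ℕ), ∀ a : Fin (2 ^ k) → ℝ,
      ∑ i, ∑ j, a i * a j * Scov H K (fun _ => lw k)
        (fun (j : Fin (2 ^ k)) e => lt' k j e) i j ≤ C * ((1/2 : ℝ) ^ k) ^ (2 * (H * K)) * ∑ i, a i ^ 2 := by
  obtain ⟨C, hC, h⟩ := level_var hH hK
  refine ⟨max C 1, by positivity, fun k a => ?_⟩
  have hn : 0 ≤ ∑ i, a i ^ 2 := Finset.sum_nonneg fun i _ => sq_nonneg _
  rcases Nat.eq_zero_or_pos k with rfl | hk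
  · have : Unique (Fin (2 ^ 0)) := inferInstanceAs (Unique (Fin 1))
    have h0 : ((default : Fin (2 ^ 0)) : ℕ) = 0 := by
      have := (default : Fin (2 ^ 0)).2
      simpa using this
    simp only [Fintype.sum_unique, Scov, Fin.sum_univ_three, lw, lt', h0]
    simp [Rbif_one hH.1 hK.1]
    nlinarith [le_max_right C 1, mul_self_nonneg (a default)]
  · refine (h (2 ^ k) ((1/2) ^ k) (by positivity) a |>.trans' ?_).trans ?_
    · simp only [lw, hk.ne', if_false, lt']
      exact le_rfl
    · gcongr; exact le_max_left _ _

end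
end BifSB

namespace BifSB

lemma dyadic_bound (f : ℝ → ℝ) (f0 : f 0 = 0) (Y : ℕ → ℝ) (hY : ∀ k, 0 ≤ Y k) (M : ℕ)
    (hξ : ∀ k < M, ∀ j < 2 ^ k, |∑ e, lw k e * f (lt' k j e)| ≤ Y k) :
    ∀ k < M, ∀ j ≤ 2 ^ k, |f ((j:ℕ) * (1/2 : ℝ) ^ k)| ≤ ∑ l ∈ Finset.range (k + 1), Y l := by
  intro k
  induction k with
  | zero =>
    intro hk j hj
    have h := hξ 0 hk 0 (by norm_num)
    simp only [lw, lt', Fin.sum_univ_three] at h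
    norm_num at h
    have : j = 0 ∨ j = 1 := by simp at hj; omega
    rcases this with rfl | rfl
    · simpa [f0] using hY 0
    · simpa using h
  | succ k ih =>
    intro hk j hj
    have ih := ih (by omega)
    rw [Finset.sum_range_succ]
    obtain ⟨i, hi⟩ := Nat.even_or_odd' j
    have hp : 2 ^ (k + 1) = 2 * 2 ^ k := by ring
    have ev : ∀ i : ℕ, (2 * (i:ℝ)) * (1/2) ^ (k + 1) = i * (1/2) ^ k := fun i => by ring
    rcases hi with rfl | rfl
    · push_cast
      rw [ev]
      linarith [ih i (by omega), hY (k + 1)]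
    · have h := hξ (k + 1) hk i (by omega)
      simp only [lw, lt', Fin.sum_univ_three, dw] at h
      simp only [Nat.add_eq_zero_iff, one_ne_zero, and_false, if_false, Matrix.cons_val_zero, Matrix.cons_val_one,
        Matrix.cons_val, Fin.val_zero, Fin.val_one, Fin.val_two, Nat.cast_zero, Nat.cast_one, Nat.cast_ofNat, add_zero] at h
      rw [ev, show (2 * (i:ℝ) + 2) * (1/2) ^ (k + 1) = ((i + 1 : ℕ) : ℝ) * (1/2) ^ k by push_cast; ring] at h
      have h1 := ih i (by omega)
      have h2 := ih (i + 1) (by omega)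
      push_cast at h1 h2 h ⊢
      rw [abs_le] at *
      constructor <;> linarith

lemma dense_bound {f : ℝ → ℝ} (hf : ContinuousOn f (Set.Ici 0)) {b : ℝ}
    (h : ∀ k j : ℕ, j ≤ 2 ^ k → |f (j * (1/2 : ℝ) ^ k)| ≤ b) {t : ℝ} (ht : t ∈ Set.Icc (0:ℝ) 1) : |f t| ≤ b := by
  have hl : Filter.Tendsto (fun k : ℕ => (⌊t * 2 ^ k⌋₊ : ℝ) * (1/2) ^ k) Filter.atTop (nhds t) := by
    have hz : Filter.Tendsto (fun k : ℕ => t - (1/2 : ℝ) ^ k) Filter.atTop (nhds t) := by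
      simpa using tendsto_const_nhds.sub (tendsto_pow_atTop_nhds_zero_of_lt_one (r := (1/2 : ℝ)) (by norm_num) (by norm_num))
    have e : ∀ k : ℕ, (2:ℝ) ^ k * (1/2) ^ k = 1 := fun k => by rw [← mul_pow]; norm_num
    refine tendsto_of_tendsto_of_tendsto_of_le_of_le hz tendsto_const_nhds (fun k => ?_) (fun k => ?_)
    · have := (Nat.lt_floor_add_one (t * 2 ^ k)).le
      have := mul_le_mul_of_nonneg_right this (show (0:ℝ) ≤ (1/2) ^ k by positivity)
      show t - (1/2) ^ k ≤ _
      rw [mul_assoc, e] at this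
      linarith
    · have := Nat.floor_le (show 0 ≤ t * 2 ^ k from mul_nonneg ht.1 (by positivity))
      have := mul_le_mul_of_nonneg_right this (show (0:ℝ) ≤ (1/2) ^ k by positivity)
      show _ ≤ t
      rw [mul_assoc, e] at this
      linarith
  have hc : Filter.Tendsto (fun k : ℕ => |f ((⌊t * 2 ^ k⌋₊ : ℝ) * (1/2) ^ k)|) Filter.atTop (nhds |f t|) := by
    have h1 := hf t ht.1
    refine (h1.tendsto.comp (tendsto_nhdsWithin_iff.2 ⟨hl, ?_⟩)).abs
    exact Filter.Eventually.of_forall fun k => by simp only [Set.mem_Ici]; positivity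
  refine le_of_tendsto hc (Filter.Eventually.of_forall fun k => h k _ ?_)
  apply Nat.floor_le_of_le
  push_cast
  exact mul_le_of_le_one_left (by positivity) ht.2

section
variable {Ω : Type*} [MeasurableSpace Ω] {μ : Measure Ω} [IsProbabilityMeasure μ] {H K : ℝ}
  {B : ℝ → Ω → ℝ}

lemma finite_prob (hB : IsBifBM μ H K B) (hH : H ∈ Set.Ioo (0:ℝ) 1) (hK : K ∈ Set.Ioc (0:ℝ) 1) :
    ∃ c₂ : ℝ, 0 < c₂ ∧ ∀ x ∈ Set.Ioo (0:ℝ) 1, ∃ X : ℕ → ℝ, (∀ k, 0 < X k) ∧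
      (∀ M, ∑ k ∈ Finset.range M, Real.sqrt 2 * X k ≤ x / 2) ∧
      ∀ M : ℕ, ENNReal.ofReal (Real.exp (-c₂ / x ^ (1 / (H * K)))) ≤
        μ {ω | ∀ p : (Σ k : Fin M, Fin (2 ^ (k:ℕ))),
          |∑ e, lw p.1 e * B (lt' p.1 p.2 e) ω| ≤ Real.sqrt 2 * X p.1} := by
  obtain ⟨C, hC, hlev⟩ := level_var' hH hK
  obtain ⟨c₂, hc₂, hp⟩ := params (mul_pos hH.1 hK.1) hC
  refine ⟨c₂, hc₂, fun x hx => ?_⟩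
  obtain ⟨X, W, s, E, hX, hW, hs, hW1, hXs, hs2, hg, hE⟩ := hp x hx
  refine ⟨X, hX, hXs, fun M => ?_⟩
  let ι := Σ k : Fin M, Fin (2 ^ (k:ℕ))
  let w : ι → Fin 3 → ℝ := fun p => lw p.1
  let t : ι → Fin 3 → ℝ := fun p e => lt' p.1 p.2 e
  have ht : ∀ i e, 0 ≤ t i e := fun i e => by simp only [t, lt']; positivity
  have hlaw := vec_law hB hH.1 hK.1 w t ht
  have hm := vec_aem hB w t ht
  have : IsProbabilityMeasure (μ.map (fun ω (i : ι) => ∑ e, w i e * B (t i e) ω)) :=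
    Measure.isProbabilityMeasure_map hm
  have hform : ∀ a : ι → ℝ, ∑ i, ∑ j, a i * a j * Scov H K w t i j ≤
      ∑ i : ι, a i ^ 2 * ((Real.toNNReal (s i.1 ^ 2) : NNReal) : ℝ) := by
    intro a
    refine (cross hB hH.1 hK.1 w t ht (fun k => W k) (fun k => hW k)
      (by rw [Fin.sum_univ_eq_sum_range]; exact hW1 M) a).trans ?_
    rw [Fintype.sum_sigma]
    refine Finset.sum_le_sum fun k _ => ?_
    have h1 := hlev k (fun i => a ⟨k, i⟩)
    have h2 := mul_le_mul_of_nonneg_left h1 (inv_nonneg.2 (hW k).le)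
    refine h2.trans (le_of_eq ?_)
    rw [← mul_assoc, hs2, Finset.mul_sum]
    refine Finset.sum_congr rfl fun i _ => ?_
    rw [Real.coe_toNNReal _ (sq_nonneg _), mul_comm]
  have key := weak_sidak (Scov H K w t) (Scov_symm H K w t) hlaw (fun i => Real.toNNReal (s i.1 ^ 2)) hform
    (fun i => X i.1)
  rw [Measure.map_apply_of_aemeasurable hm (by
    rw [Set.ofPred_forall]
    exact MeasurableSet.iInter fun i => measurableSet_le (by fun_prop) (by fun_prop))] at key
  refine le_trans ?_ key
  have hprod : ENNReal.ofReal (Real.exp (-(∑ k ∈ Finset.range M, (2:ℝ) ^ k * E k))) ≤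
      ∏ i : ι, gaussianReal 0 (Real.toNNReal (s i.1 ^ 2)) {y | |y| ≤ X i.1} := by
    have : Real.exp (-(∑ k ∈ Finset.range M, (2:ℝ) ^ k * E k)) = ∏ i : ι, Real.exp (-(E i.1)) := by
      rw [← Real.exp_sum, Fintype.sum_sigma, ← Fin.sum_univ_eq_sum_range (fun k => (2:ℝ) ^ k * E k),
        ← Finset.sum_neg_distrib]
      congr 1
      refine Finset.sum_congr rfl fun k _ => ?_
      simp
    rw [this, ENNReal.ofReal_prod_of_nonneg (fun _ _ => (Real.exp_pos _).le)]
    exact Finset.prod_le_prod' fun i _ => hg i.1 _ (Real.coe_toNNReal _ (sq_nonneg _))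
  refine le_trans ?_ (pow_le_pow_left' hprod 2)
  rw [← ENNReal.ofReal_pow (Real.exp_pos _).le, ← Real.exp_nat_mul]
  apply ENNReal.ofReal_le_ofReal
  rw [Real.exp_le_exp, neg_div]
  have := hE M
  push_cast
  linarith

lemma lower_bound (hB : IsBifBM μ H K B) (hH : H ∈ Set.Ioo (0:ℝ) 1) (hK : K ∈ Set.Ioc (0:ℝ) 1) :
    ∃ c₂ : ℝ, 0 < c₂ ∧ ∀ t₀ ∈ Set.Icc (0:ℝ) 1, ∀ x ∈ Set.Ioo (0:ℝ) 1,
      ENNReal.ofReal (Real.exp (-c₂ / x ^ (1 / (H * K)))) ≤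
        μ {ω | (⨆ t : Set.Icc (0:ℝ) 1, |B t ω - B t₀ ω|) ≤ x} := by
  obtain ⟨c₂, hc₂, h⟩ := finite_prob hB hH hK
  refine ⟨c₂, hc₂, fun t₀ ht₀ x hx => ?_⟩
  obtain ⟨X, hX, hXs, hM⟩ := h x hx
  set A : ℕ → Set Ω := fun M => {ω | ∀ k < M, ∀ j ≤ 2 ^ k, |B ((j:ℕ) * (1/2 : ℝ) ^ k) ω| ≤ x / 2} with hA
  have hAn : ∀ M, NullMeasurableSet (A M) μ := by
    intro M
    simp only [hA, Set.ofPred_forall]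
    refine NullMeasurableSet.iInter fun k => NullMeasurableSet.iInter fun _ => NullMeasurableSet.iInter fun j =>
      NullMeasurableSet.iInter fun _ => ?_
    exact nullMeasurableSet_le (one_aem hB (by positivity)).abs aemeasurable_const
  have hAa : Antitone A := fun M N hMN ω hω k hk => hω k (lt_of_lt_of_le hk hMN)
  have hAM : ∀ M, ENNReal.ofReal (Real.exp (-c₂ / x ^ (1 / (H * K)))) ≤ μ (A M) := by
    intro M
    refine (hM M).trans (measure_mono_ae ?_)
    filter_upwards [B_zero hB hH.1 hK.1] with ω h0 hω k hk j hj
    refine (dyadic_bound (fun t => B t ω) h0 (fun k => Real.sqrt 2 * X k)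
      (fun k => by have := hX k; positivity) M ?_ k hk j hj).trans (hXs _)
    intro k hk j hj
    exact hω ⟨⟨k, hk⟩, ⟨j, hj⟩⟩
  have hlim := tendsto_measure_iInter_atTop hAn hAa ⟨0, measure_ne_top μ _⟩
  refine (ge_of_tendsto' hlim hAM).trans (measure_mono_ae ?_)
  filter_upwards [hB.1] with ω hc hω
  have hb : ∀ t ∈ Set.Icc (0:ℝ) 1, |B t ω| ≤ x / 2 := fun t ht =>
    dense_bound hc (fun k j hj => Set.mem_iInter.1 hω (k + 1) k (Nat.lt_succ_self k) j hj) ht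
  show (⨆ t : Set.Icc (0:ℝ) 1, |B t ω - B t₀ ω|) ≤ x
  have : Nonempty (Set.Icc (0:ℝ) 1) := ⟨⟨0, by simp⟩⟩
  refine ciSup_le fun t => ?_
  have h1 := hb t t.2
  have h2 := hb t₀ ht₀
  have := abs_sub (B t ω) (B t₀ ω)
  linarith

end
end BifSB

/-- Lemma 3.2, small ball probabilities: there are `c₂, c₃ > 0`
such that for all `t₀ ∈ [0,1]` and `x ∈ (0,1)`,
`exp(-c₂/x^{1/(HK)}) ≤ P{max_{t∈[0,1]} |B(t) - B(t₀)| ≤ x} ≤ exp(-c₃/x^{1/(HK)})`. -/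
theorem bifBM_small_ball {Ω : Type*} [MeasurableSpace Ω] (μ : Measure Ω)
    [IsProbabilityMeasure μ] (H K : ℝ) (hH : H ∈ Set.Ioo (0:ℝ) 1)
    (hK : K ∈ Set.Ioc (0:ℝ) 1) (B : ℝ → Ω → ℝ) (hB : IsBifBM μ H K B) :
    ∃ c₂ c₃ : ℝ, 0 < c₂ ∧ 0 < c₃ ∧
      ∀ t₀ ∈ Set.Icc (0:ℝ) 1, ∀ x ∈ Set.Ioo (0:ℝ) 1,
        ENNReal.ofReal (Real.exp (-c₂ / x ^ (1 / (H * K)))) ≤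
            μ {ω | (⨆ t : Set.Icc (0:ℝ) 1, |B t ω - B t₀ ω|) ≤ x} ∧
          μ {ω | (⨆ t : Set.Icc (0:ℝ) 1, |B t ω - B t₀ ω|) ≤ x} ≤
            ENNReal.ofReal (Real.exp (-c₃ / x ^ (1 / (H * K)))) := by
  obtain ⟨c₂, hc₂, h₂⟩ := BifSB.lower_bound hB hH hK
  obtain ⟨c₃, hc₃, h₃⟩ := BifSB.upper_bound hB hH hK
  exact ⟨c₂, c₃, hc₂, hc₃, fun t₀ ht₀ x hx => ⟨h₂ t₀ ht₀ x hx, h₃ t₀ ht₀ x hx⟩⟩
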